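/- Let g be the finite-dimensional simple Lie algebra of type E₈ over ℂ, and let (h,e,f) be an sl₂-triple in g. Then every eigenvalue of the endomorphism of the quotient Lie algebra g_e/[g_e,g_e] induced by ad h is a non-negative even integer. -/

import Mathlib

/-- The centralizer `g_e` of `e`, i.e. the kernel of `ad e`. -/
noncomputable def centralizer (e : LieAlgebra.e₈ ℂ) : Submodule ℂ (LieAlgebra.e₈ ℂ) :=
  LinearMap.ker (LieAlgebra.ad ℂ (LieAlgebra.e₈ ℂ) e)

/-- The derived subalgebra `[g_e, g_e]` of the centralizer, as the linear span of all
brackets of pairs of elements of `g_e`. -/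
noncomputable def derived (e : LieAlgebra.e₈ ℂ) : Submodule ℂ (LieAlgebra.e₈ ℂ) :=
  Submodule.span ℂ
    {z : LieAlgebra.e₈ ℂ | ∃ x ∈ centralizer e, ∃ y ∈ centralizer e, ⁅x, y⁆ = z}

namespace SerreE8

open Module LieAlgebra

/-- The pairing `⟨α_i^∨, v⟩` of a simple coroot with an element of the root lattice. -/
def pair (i : Fin 8) (v : Fin 8 → ℤ) : ℤ := ∑ j, CartanMatrix.E₈ i j * v j

lemma pair_add (i : Fin 8) (v w : Fin 8 → ℤ) : pair i (v + w) = pair i v + pair i w := by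
  simp [pair, mul_add, Finset.sum_add_distrib]

lemma pair_neg (i : Fin 8) (v : Fin 8 → ℤ) : pair i (-v) = -pair i v := by
  simp [pair]

lemma pair_zero (i : Fin 8) : pair i 0 = 0 := by
  simp [pair]

lemma pair_smul (i : Fin 8) (c : ℤ) (v : Fin 8 → ℤ) : pair i (c • v) = c * pair i v := by
  simp only [pair, Pi.smul_apply, smul_eq_mul, Finset.mul_sum]
  exact Finset.sum_congr rfl fun _ _ => by ring

lemma pair_single (i j : Fin 8) : pair i (Pi.single j 1) = CartanMatrix.E₈ i j := by
  simp [pair, Pi.single_apply]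

lemma pair_single_self (i : Fin 8) : pair i (Pi.single i 1) = 2 := by
  simp [pair_single]

lemma exists_separating : ∃ c : Fin 8 → ℂ,
    Function.Injective fun v : Fin 8 → ℤ => ∑ i, c i * (pair i v : ℂ) := by
  obtain ⟨t, ht⟩ : ∃ t : ℂ, Transcendental ℤ t := by
    have := (transcendental_liouvilleNumber (m := 2) le_rfl)
    refine ⟨((liouvilleNumber 2 : ℝ) : ℂ), ?_⟩
    have := (transcendental_algebraMap_iff (R := ℤ) (S := ℝ) (A := ℂ)
      (FaithfulSMul.algebraMap_injective ℝ ℂ)).2 this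
    simpa using this
  have hdet : IsUnit (CartanMatrix.E₈).det := by rw [CartanMatrix.E₈_det]; exact isUnit_one
  set B := (CartanMatrix.E₈)⁻¹ with hB
  refine ⟨fun i => ∑ k : Fin 8, t ^ (k : ℕ) * (B k i : ℂ), fun v w hvw => ?_⟩
  have key : ∀ v : Fin 8 → ℤ,
      ∑ i, (∑ k : Fin 8, t ^ (k : ℕ) * (B k i : ℂ)) * (pair i v : ℂ)
        = Polynomial.aeval t (∑ k : Fin 8, Polynomial.monomial (k : ℕ) (v k)) := by
    intro v
    have h1 : ∀ k, ∑ i, B k i * pair i v = v k := by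
      intro k
      have : B.mulVec ((CartanMatrix.E₈).mulVec v) = v := by
        rw [Matrix.mulVec_mulVec, hB, Matrix.nonsing_inv_mul _ hdet, Matrix.one_mulVec]
      exact congrFun this k
    simp only [map_sum, Polynomial.aeval_monomial, Finset.sum_mul]
    rw [Finset.sum_comm]
    refine Finset.sum_congr rfl fun k _ => ?_
    rw [← h1 k]
    simp only [map_sum, map_mul, Finset.sum_mul]
    refine Finset.sum_congr rfl fun i _ => ?_
    simp only [algebraMap_int_eq, eq_intCast]
    ring
  dsimp only at hvw
  rw [key, key] at hvw
  have := (transcendental_iff_injective.1 ht) hvw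
  funext k
  have h2 := congrArg (fun p => p.coeff (k : ℕ)) this
  simpa [Polynomial.finsetSum_coeff, Polynomial.coeff_monomial, Fin.val_inj] using h2

/-- Coefficients of an element of the Cartan subalgebra separating all root lattice weights. -/
noncomputable def sepCoeff : Fin 8 → ℂ := exists_separating.choose

/-- The (injective) evaluation of root lattice weights on the separating element. -/
noncomputable def sepEval : (Fin 8 → ℤ) →+ ℂ where
  toFun v := ∑ i, sepCoeff i * (pair i v : ℂ)
  map_zero' := by simp [pair_zero]
  map_add' v w := by simp [pair_add, mul_add, Finset.sum_add_distrib]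

lemma sepEval_injective : Function.Injective sepEval := exists_separating.choose_spec

variable {L : Type*} [LieRing L] [LieAlgebra ℂ L]

/-- Elements of a complex Lie algebra which generate it and satisfy the Serre relations of type
`E₈`. -/
structure IsSerreSystem (H E F : Fin 8 → L) : Prop where
  lie_h_h : ∀ i j, ⁅H i, H j⁆ = 0
  lie_e_f_same : ∀ i, ⁅E i, F i⁆ = H i
  lie_e_f_ne : ∀ i j, i ≠ j → ⁅E i, F j⁆ = 0
  lie_h_e : ∀ i j, ⁅H i, E j⁆ = (CartanMatrix.E₈ i j : ℂ) • E j
  lie_h_f : ∀ i j, ⁅H i, F j⁆ = -(CartanMatrix.E₈ i j : ℂ) • F j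
  ad_e : ∀ i j, (ad ℂ L (E i) ^ (-CartanMatrix.E₈ i j).toNat) ⁅E i, E j⁆ = 0
  ad_f : ∀ i j, (ad ℂ L (F i) ^ (-CartanMatrix.E₈ i j).toNat) ⁅F i, F j⁆ = 0
  eq_top : ∀ S : LieSubalgebra ℂ L, (∀ i, E i ∈ S) → (∀ i, F i ∈ S) → S = ⊤

/-- The separating element of the Cartan subalgebra. -/
noncomputable def sepElt (H : Fin 8 → L) : L := ∑ i, sepCoeff i • H i

/-- The weight space attached to an element of the root lattice. -/
noncomputable def wtSpace (H : Fin 8 → L) (v : Fin 8 → ℤ) : Submodule ℂ L :=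
  (ad ℂ L (sepElt H)).eigenspace (sepEval v)

/-- Iterated brackets `[X i₁, [X i₂, … X iₙ]]`. -/
def mon (X : Fin 8 → L) : List (Fin 8) → L
  | [] => 0
  | [i] => X i
  | i :: j :: l => ⁅X i, mon X (j :: l)⁆

/-- The degree of a word. -/
def deg (l : List (Fin 8)) : Fin 8 → ℤ := fun j => (l.count j : ℤ)

lemma deg_cons (i : Fin 8) (l : List (Fin 8)) : deg (i :: l) = Pi.single i 1 + deg l := by
  funext j
  by_cases h : i = j
  · subst h; simp [deg, add_comm]
  · simp [deg, h, Ne.symm h]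

lemma deg_nonneg (l : List (Fin 8)) : 0 ≤ deg l := fun j => by simp [deg]

lemma deg_eq_zero {l : List (Fin 8)} (h : deg l = 0) : l = [] := by
  cases l with
  | nil => rfl
  | cons i l =>
    have h1 := congrFun h i
    have h2 := deg_nonneg l i
    simp only [deg_cons, Pi.add_apply, Pi.single_eq_same, Pi.zero_apply] at h1 h2
    omega

lemma mem_of_deg_eq_smul {l : List (Fin 8)} {k : ℤ} {i : Fin 8}
    (h : deg l = k • Pi.single i 1) : ∀ j ∈ l, j = i := by
  intro j hj
  by_contra hne
  have h1 := congrFun h j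
  simp only [deg, Pi.smul_apply, Pi.single_apply, hne, if_false, smul_zero] at h1
  exact (List.count_pos_iff.2 hj).ne' (by exact_mod_cast h1)

omit [LieAlgebra ℂ L] in
lemma mon_cons_of_ne_nil (X : Fin 8 → L) (i : Fin 8) {l : List (Fin 8)} (hl : l ≠ []) :
    mon X (i :: l) = ⁅X i, mon X l⁆ := by
  cases l with
  | nil => exact absurd rfl hl
  | cons j l => rfl

omit [LieAlgebra ℂ L] in
lemma mon_eq_zero (X : Fin 8 → L) {i j : Fin 8} {l : List (Fin 8)}
    (h : ∀ k ∈ i :: j :: l, k = (i : Fin 8)) : mon X (i :: j :: l) = 0 := by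
  induction l generalizing j with
  | nil =>
    have : j = i := h j (by simp)
    simp [mon, this]
  | cons k l ih =>
    have hj : j = i := h j (by simp)
    have hk : k = i := h k (by simp)
    have := ih (j := k) (fun m hm => h m (by
      simp only [List.mem_cons] at hm ⊢; tauto))
    subst hj
    rw [mon_cons_of_ne_nil _ _ (by simp), this, lie_zero]

namespace IsSerreSystem

variable {H E F : Fin 8 → L} (hS : IsSerreSystem H E F)
include hS

lemma symm : IsSerreSystem (-H) F E where
  lie_h_h i j := by simp [hS.lie_h_h]
  lie_e_f_same i := by rw [← lie_skew, hS.lie_e_f_same]; rfl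
  lie_e_f_ne i j h := by rw [← lie_skew, hS.lie_e_f_ne _ _ h.symm, neg_zero]
  lie_h_e i j := by simp [hS.lie_h_f]
  lie_h_f i j := by simp [hS.lie_h_e]
  ad_e := hS.ad_f
  ad_f := hS.ad_e
  eq_top S h1 h2 := hS.eq_top S h2 h1

lemma lie_h_mon (i : Fin 8) (l : List (Fin 8)) :
    ⁅H i, mon E l⁆ = (pair i (deg l) : ℂ) • mon E l := by
  induction l with
  | nil => simp [mon]
  | cons j l ih =>
    rcases eq_or_ne l [] with rfl | hl
    · have : deg [] = 0 := rfl
      simp [mon, hS.lie_h_e, deg_cons, this, pair_single]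
    · rw [mon_cons_of_ne_nil _ _ hl, leibniz_lie, ih, hS.lie_h_e, deg_cons, pair_add, pair_single]
      simp [add_smul]

lemma lie_f_mon (j : Fin 8) (l : List (Fin 8)) :
    ⁅F j, mon E l⁆ ∈ Submodule.span ℂ (Set.range (mon E)) ⊔ Submodule.span ℂ (Set.range H) := by
  induction l with
  | nil => simp [mon]
  | cons i l ih =>
    have hij : ⁅F j, E i⁆ ∈ Submodule.span ℂ (Set.range H) := by
      rw [← lie_skew]
      rcases eq_or_ne i j with rfl | h
      · rw [hS.lie_e_f_same]; exact neg_mem (Submodule.subset_span ⟨_, rfl⟩)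
      · rw [hS.lie_e_f_ne _ _ h]; simp
    rcases eq_or_ne l [] with rfl | hl
    · exact Submodule.mem_sup_right hij
    · rw [mon_cons_of_ne_nil _ _ hl, leibniz_lie]
      refine add_mem ?_ ?_
      · refine Submodule.span_induction (p := fun x _ => ⁅x, mon E l⁆ ∈ _) ?_ ?_ ?_ ?_ hij
        · rintro _ ⟨k, rfl⟩
          rw [hS.lie_h_mon]
          exact Submodule.mem_sup_left (Submodule.smul_mem _ _ (Submodule.subset_span ⟨_, rfl⟩))
        · simp
        · intro x y _ _ hx hy; rw [add_lie]; exact add_mem hx hy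
        · intro a x _ hx; rw [smul_lie]; exact Submodule.smul_mem _ _ hx
      · obtain ⟨u, hu, w, hw, huw⟩ := Submodule.mem_sup.1 ih
        rw [← huw, lie_add]
        refine Submodule.mem_sup_left (add_mem ?_ ?_)
        · refine Submodule.span_induction (p := fun x _ => ⁅E i, x⁆ ∈ _) ?_ ?_ ?_ ?_ hu
          · rintro _ ⟨k, rfl⟩
            rcases eq_or_ne k [] with rfl | hk
            · simp [mon]
            · rw [← mon_cons_of_ne_nil _ _ hk]; exact Submodule.subset_span ⟨_, rfl⟩
          · simp
          · intro x y _ _ hx hy; rw [lie_add]; exact add_mem hx hy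
          · intro a x _ hx; rw [lie_smul]; exact Submodule.smul_mem _ _ hx
        · refine Submodule.span_induction (p := fun x _ => ⁅E i, x⁆ ∈ _) ?_ ?_ ?_ ?_ hw
          · rintro _ ⟨k, rfl⟩
            rw [← lie_skew, hS.lie_h_e]
            exact neg_mem (Submodule.smul_mem _ _ (Submodule.subset_span ⟨[i], rfl⟩))
          · simp
          · intro x y _ _ hx hy; rw [lie_add]; exact add_mem hx hy
          · intro a x _ hx; rw [lie_smul]; exact Submodule.smul_mem _ _ hx

lemma lie_e_mem_aux (i : Fin 8) {x : L}
    (hx : x ∈ Submodule.span ℂ (Set.range (mon E)) ⊔ Submodule.span ℂ (Set.range H) ⊔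
      Submodule.span ℂ (Set.range (mon F))) :
    ⁅E i, x⁆ ∈ Submodule.span ℂ (Set.range (mon E)) ⊔ Submodule.span ℂ (Set.range H) ⊔
      Submodule.span ℂ (Set.range (mon F)) := by
  rw [← Submodule.span_union, ← Submodule.span_union] at hx
  refine Submodule.span_induction (p := fun x _ => ⁅E i, x⁆ ∈ _) ?_ ?_ ?_ ?_ hx
  · rintro _ ((⟨k, rfl⟩ | ⟨k, rfl⟩) | ⟨k, rfl⟩)
    · rcases eq_or_ne k [] with rfl | hk
      · simp [mon]
      · rw [← mon_cons_of_ne_nil _ _ hk]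
        exact Submodule.mem_sup_left (Submodule.mem_sup_left (Submodule.subset_span ⟨_, rfl⟩))
    · rw [← lie_skew, hS.lie_h_e]
      exact neg_mem (Submodule.smul_mem _ _ (Submodule.mem_sup_left
        (Submodule.mem_sup_left (Submodule.subset_span ⟨[i], rfl⟩))))
    · have := hS.symm.lie_f_mon i k
      have h2 : Submodule.span ℂ (Set.range (-H)) ≤ Submodule.span ℂ (Set.range H) := by
        rw [Submodule.span_le]; rintro _ ⟨j, rfl⟩
        exact neg_mem (Submodule.subset_span ⟨j, rfl⟩)
      exact sup_le (c := _ ⊔ _ ⊔ _) le_sup_right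
        ((h2.trans le_sup_right).trans le_sup_left) this
  · simp
  · intro x y _ _ hx hy; rw [lie_add]; exact add_mem hx hy
  · intro a x _ hx; rw [lie_smul]; exact Submodule.smul_mem _ _ hx

lemma span_eq_top : Submodule.span ℂ (Set.range (mon E)) ⊔ Submodule.span ℂ (Set.range H) ⊔
      Submodule.span ℂ (Set.range (mon F)) = ⊤ := by
  set P := Submodule.span ℂ (Set.range (mon E)) ⊔ Submodule.span ℂ (Set.range H) ⊔
      Submodule.span ℂ (Set.range (mon F)) with hP
  have hneg : Submodule.span ℂ (Set.range (-H)) = Submodule.span ℂ (Set.range H) := by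
    apply le_antisymm <;> rw [Submodule.span_le] <;> rintro _ ⟨j, rfl⟩
    · exact neg_mem (Submodule.subset_span ⟨j, rfl⟩)
    · rw [← neg_neg (H j)]; exact neg_mem (Submodule.subset_span ⟨j, rfl⟩)
  have hP' : P = Submodule.span ℂ (Set.range (mon F)) ⊔ Submodule.span ℂ (Set.range (-H)) ⊔
      Submodule.span ℂ (Set.range (mon E)) := by
    rw [hP, hneg]; ac_rfl
  let S : LieSubalgebra ℂ L :=
    { carrier := {x | ∀ y ∈ P, ⁅x, y⁆ ∈ P}
      add_mem' := fun {a b} ha hb y hy => by rw [add_lie]; exact add_mem (ha y hy) (hb y hy)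
      zero_mem' := fun y _ => by simp
      smul_mem' := fun c x hx y hy => by rw [smul_lie]; exact Submodule.smul_mem _ _ (hx y hy)
      lie_mem' := fun {a b} ha hb y hy => by
        rw [lie_lie]; exact sub_mem (ha _ (hb y hy)) (hb _ (ha y hy)) }
  have hStop : S = ⊤ := hS.eq_top S (fun i y hy => hS.lie_e_mem_aux i hy) (fun i y hy => by
    rw [hP'] at hy ⊢; exact hS.symm.lie_e_mem_aux i hy)
  let S' : LieSubalgebra ℂ L :=
    { P with
      lie_mem' := fun {a b} _ hb => by
        have : a ∈ S := by rw [hStop]; trivial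
        exact this b hb }
  have : S' = ⊤ := hS.eq_top S'
    (fun i => Submodule.mem_sup_left (Submodule.mem_sup_left (Submodule.subset_span ⟨[i], rfl⟩)))
    (fun i => Submodule.mem_sup_right (Submodule.subset_span ⟨[i], rfl⟩))
  rw [eq_top_iff]
  intro x _
  have hx : x ∈ S' := by rw [this]; trivial
  exact hx

end IsSerreSystem

end SerreE8

namespace SerreE8

open Module LieAlgebra

variable {L : Type*} [LieRing L] [LieAlgebra ℂ L]

lemma wtSpace_neg (H : Fin 8 → L) (v : Fin 8 → ℤ) : wtSpace (-H) v = wtSpace H (-v) := by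
  have : sepElt (-H) = -sepElt H := by simp [sepElt]
  ext x
  simp only [wtSpace, Module.End.mem_eigenspace_iff, this, map_neg, LinearMap.neg_apply, neg_smul]
  rw [neg_eq_iff_eq_neg]

lemma iSupIndep_wtSpace (H : Fin 8 → L) : iSupIndep (wtSpace H) :=
  (Module.End.eigenspaces_iSupIndep (ad ℂ L (sepElt H))).comp sepEval_injective

/-- The vectors out of a spanning family which have a given weight. -/
def wtSpan (H E F : Fin 8 → L) (v : Fin 8 → ℤ) : Submodule ℂ L :=
  Submodule.span ℂ {x | (∃ l, deg l = v ∧ mon E l = x) ∨ (∃ l, -deg l = v ∧ mon F l = x) ∨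
    (v = 0 ∧ ∃ i, H i = x)}

namespace IsSerreSystem

variable {H E F : Fin 8 → L} (hS : IsSerreSystem H E F)
include hS

lemma lie_h_of_mem_wtSpan {v : Fin 8 → ℤ} {x : L} (hx : x ∈ wtSpan H E F v) (i : Fin 8) :
    ⁅H i, x⁆ = (pair i v : ℂ) • x := by
  have : wtSpan H E F v ≤ (ad ℂ L (H i)).eigenspace (pair i v : ℂ) := by
    rw [wtSpan, Submodule.span_le]
    rintro _ (⟨l, rfl, rfl⟩ | ⟨l, rfl, rfl⟩ | ⟨rfl, j, rfl⟩)
    · simpa using hS.lie_h_mon i l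
    · have := hS.symm.lie_h_mon i l
      simp only [Pi.neg_apply, neg_lie] at this
      simp [pair_neg, ← this]
    · simp [hS.lie_h_h, pair_zero]
  exact Module.End.mem_eigenspace_iff.1 (this hx)

lemma wtSpan_le (v : Fin 8 → ℤ) : wtSpan H E F v ≤ wtSpace H v := by
  intro x hx
  simp [wtSpace, sepElt, hS.lie_h_of_mem_wtSpan hx,
    sepEval, Finset.sum_smul, mul_smul]

lemma iSup_wtSpan : ⨆ v, wtSpan H E F v = ⊤ := by
  rw [eq_top_iff, ← hS.span_eq_top]
  refine sup_le (sup_le ?_ ?_) ?_ <;> rw [Submodule.span_le] <;> rintro _ ⟨l, rfl⟩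
  · exact (le_iSup (wtSpan H E F) (deg l)) (Submodule.subset_span (Or.inl ⟨l, rfl, rfl⟩))
  · exact (le_iSup (wtSpan H E F) 0) (Submodule.subset_span (Or.inr (Or.inr ⟨rfl, l, rfl⟩)))
  · exact (le_iSup (wtSpan H E F) (-deg l))
      (Submodule.subset_span (Or.inr (Or.inl ⟨l, rfl, rfl⟩)))

lemma wtSpan_eq (v : Fin 8 → ℤ) : wtSpan H E F v = wtSpace H v :=
  congrFun (((iSupIndep_wtSpace H).le_iff_eq_of_iSup_eq_top hS.iSup_wtSpan).1 hS.wtSpan_le) v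

lemma iSup_wtSpace : ⨆ v, wtSpace H v = ⊤ := by
  rw [← hS.iSup_wtSpan]; simp_rw [hS.wtSpan_eq]

lemma lie_h {v : Fin 8 → ℤ} {x : L} (hx : x ∈ wtSpace H v) (i : Fin 8) :
    ⁅H i, x⁆ = (pair i v : ℂ) • x :=
  hS.lie_h_of_mem_wtSpan (hS.wtSpan_eq v ▸ hx) i

omit hS in
lemma lie_mem {v w : Fin 8 → ℤ} {x y : L} (hx : x ∈ wtSpace H v) (hy : y ∈ wtSpace H w) :
    ⁅x, y⁆ ∈ wtSpace H (v + w) := by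
  simp only [wtSpace, Module.End.mem_eigenspace_iff, ad_apply] at *
  rw [leibniz_lie, hx, hy, map_add, smul_lie, lie_smul, add_smul]

lemma e_mem (i : Fin 8) : E i ∈ wtSpace H (Pi.single i 1) := by
  rw [← hS.wtSpan_eq]
  refine Submodule.subset_span (Or.inl ⟨[i], ?_, rfl⟩)
  rw [deg_cons, show deg [] = 0 from rfl, add_zero]

lemma nonneg_or_nonpos {v : Fin 8 → ℤ} (hv : wtSpace H v ≠ ⊥) : 0 ≤ v ∨ v ≤ 0 := by
  rw [← hS.wtSpan_eq] at hv
  by_contra hcon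
  apply hv
  rw [wtSpan, Submodule.span_eq_bot]
  rintro _ (⟨l, rfl, rfl⟩ | ⟨l, rfl, rfl⟩ | ⟨rfl, j, rfl⟩)
  · exact absurd (Or.inl (deg_nonneg l)) hcon
  · exact absurd (Or.inr (neg_nonpos.2 (deg_nonneg l))) hcon
  · exact absurd (Or.inl le_rfl) hcon

lemma wtSpace_zero : wtSpace H 0 = Submodule.span ℂ (Set.range H) := by
  rw [← hS.wtSpan_eq]
  apply le_antisymm <;> rw [wtSpan, Submodule.span_le]
  · rintro _ (⟨l, hl, rfl⟩ | ⟨l, hl, rfl⟩ | ⟨-, j, rfl⟩)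
    · rw [deg_eq_zero hl]; exact zero_mem _
    · rw [deg_eq_zero (neg_eq_zero.1 hl)]; exact zero_mem _
    · exact Submodule.subset_span ⟨j, rfl⟩
  · rintro _ ⟨j, rfl⟩
    exact Submodule.subset_span (Or.inr (Or.inr ⟨rfl, j, rfl⟩))

lemma wtSpace_single_aux {i : Fin 8} {k : ℤ} (hk : 0 < k) {x : L}
    (hx : x ∈ wtSpace H (k • Pi.single i 1)) :
    (k = 1 ∧ x ∈ Submodule.span ℂ {E i}) ∨ x = 0 := by
  rw [← hS.wtSpan_eq] at hx
  have key : wtSpan H E F (k • Pi.single i 1) ≤ if k = 1 then Submodule.span ℂ {E i} else ⊥ := by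
    rw [wtSpan, Submodule.span_le]
    have hi : (k • (Pi.single i 1 : Fin 8 → ℤ)) i = k := by simp
    rintro _ (⟨l, hl, rfl⟩ | ⟨l, hl, rfl⟩ | ⟨h0, j, rfl⟩)
    · have hall := mem_of_deg_eq_smul hl
      match l, hl, hall with
      | [], hl, _ => simp [mon]
      | [j], hl, hall =>
        have hj : j = i := hall j (by simp)
        subst hj
        have : k = 1 := by
          have h3 := congrFun hl j
          rw [hi] at h3; simpa [deg] using h3.symm
        simp [this, mon, Submodule.mem_span_singleton_self]
      | j :: j' :: l, hl, hall =>
        have hj : j = i := hall j (by simp)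
        subst hj
        rw [mon_eq_zero _ hall]; exact zero_mem _
    · have := congrFun hl i
      rw [hi] at this
      have h2 := deg_nonneg l i
      simp only [Pi.neg_apply, Pi.zero_apply] at this h2
      omega
    · have := congrFun h0 i
      rw [hi] at this
      simp only [Pi.zero_apply] at this
      omega
  have := key hx
  split_ifs at this with h
  · exact Or.inl ⟨h, this⟩
  · exact Or.inr (by simpa using this)

end IsSerreSystem
end SerreE8

namespace SerreE8

/-- The positive roots of type `E₈`, the coordinates being given as digits in base `8`. -/
def rootCodes : List ℕ :=
  [1, 8, 64, 512, 4096, 32768, 262144, 2097152, 65, 520, 576, 4608, 36864, 294912, 2359296, 577,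
   584, 4616, 4672, 37376, 299008, 2392064, 585, 4673, 4680, 37384, 37440, 299520, 2396160, 4681,
   5192, 37441, 37448, 299528, 299584, 2396672, 5193, 37449, 37960, 299585, 299592, 2396680,
   2396736, 5257, 37961, 42056, 299593, 300104, 2396737, 2396744, 38025, 42057, 300105, 304200,
   2396745, 2397256, 42121, 300169, 304201, 336968, 2397257, 2401352, 42633, 304265, 336969,
   2397321, 2401353, 2434120, 42641, 304777, 337033, 2401417, 2434121, 2696264, 304785, 337545,
   2401929, 2434185, 2696265, 337553, 341641, 2401937, 2434697, 2696329, 341649, 2434705,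
   2438793, 2696841, 342161, 2438801, 2696849, 2700937, 342225, 2439313, 2700945, 2733705,
   342226, 2439377, 2701457, 2733713, 2439378, 2701521, 2734225, 2701522, 2734289, 2738321,
   2734290, 2738385, 2738386, 2738897, 2738898, 2738905, 2738906, 2738962, 2738970, 2739482,
   2743578, 2776346, 3038490, 5135642]

/-- The vector with given octal digits. -/
def digits (n : ℕ) : Fin 8 → ℤ := fun j => ((n >>> (3 * (j : ℕ))) % 8 : ℕ)

/-- The positive roots of type `E₈` in terms of the simple roots. -/
def posRoots : List (Fin 8 → ℤ) := rootCodes.map digits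

/-- The reflection attached to a simple root. -/
def refl (i : Fin 8) (v : Fin 8 → ℤ) : Fin 8 → ℤ := v - pair i v • Pi.single i 1

lemma pair_refl (i : Fin 8) (v : Fin 8 → ℤ) : pair i (refl i v) = -pair i v := by
  rw [refl, sub_eq_add_neg, pair_add, pair_neg, pair_smul, pair_single_self]; ring

lemma refl_refl (i : Fin 8) (v : Fin 8 → ℤ) : refl i (refl i v) = v := by
  rw [refl, pair_refl, refl]; simp

lemma refl_neg (i : Fin 8) (v : Fin 8 → ℤ) : refl i (-v) = -refl i v := by
  simp only [refl, pair_neg]; simp; abel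

lemma refl_add (i : Fin 8) (v w : Fin 8 → ℤ) : refl i (v + w) = refl i v + refl i w := by
  simp only [refl, pair_add, add_smul]; abel

lemma refl_single (i : Fin 8) : refl i (Pi.single i 1) = -Pi.single i 1 := by
  rw [refl, pair_single_self, two_smul]; abel

lemma refl_apply_of_ne {i j : Fin 8} (h : j ≠ i) (v : Fin 8 → ℤ) : refl i v j = v j := by
  simp [refl, h]

lemma refl_apply_self (i : Fin 8) (v : Fin 8 → ℤ) : refl i v i = v i - pair i v := by
  simp [refl]

/-- The list of neighbours of a vertex of the Dynkin diagram of type `E₈`. -/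
def nbrs : Fin 8 → List (Fin 8) :=
  ![[2], [3], [0, 3], [1, 2, 4], [3, 5], [4, 6], [5, 7], [6]]

lemma pair_eq (i : Fin 8) (v : Fin 8 → ℤ) : pair i v = 2 * v i - ((nbrs i).map v).sum := by
  fin_cases i <;> simp [pair, Fin.sum_univ_eight, CartanMatrix.E₈, nbrs] <;> ring

/-- A check that the list of positive roots is stable under a simple reflection, apart from the
simple root. -/
def reflCheck : Bool :=
  rootCodes.all fun n => (List.finRange 8).all fun i => n == 1 <<< (3 * (i : ℕ)) ||
    let p := 2 * digits n i - ((nbrs i).map (digits n)).sum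
    let m := ((n : ℤ) - p * ((1 <<< (3 * (i : ℕ)) : ℕ) : ℤ)).toNat
    rootCodes.contains m && (List.finRange 8).all fun j =>
      digits m j == if j = i then digits n i - p else digits n j

lemma reflCheck_eq : reflCheck = true := by decide +kernel

lemma single_mem_posRoots (i : Fin 8) : Pi.single i 1 ∈ posRoots := by
  have h : ∀ i : Fin 8, 1 <<< (3 * (i : ℕ)) ∈ rootCodes ∧
      ∀ j, digits (1 <<< (3 * (i : ℕ))) j = if j = i then 1 else 0 := by decide +kernel
  refine List.mem_map.2 ⟨_, (h i).1, ?_⟩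
  funext j
  rw [(h i).2, Pi.single_apply]

lemma refl_mem_posRoots {v : Fin 8 → ℤ} (hv : v ∈ posRoots) (i : Fin 8)
    (hi : v ≠ Pi.single i 1) : refl i v ∈ posRoots := by
  obtain ⟨n, hn, rfl⟩ := List.mem_map.1 hv
  have h := reflCheck_eq
  simp only [reflCheck, List.all_eq_true] at h
  have h1 := h n hn i (List.mem_finRange i)
  simp only [Bool.or_eq_true, Bool.and_eq_true, beq_iff_eq, List.all_eq_true, ← pair_eq,
    List.contains_iff_mem] at h1
  rcases h1 with h1 | ⟨h1, h2⟩
  · refine absurd ?_ hi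
    have h : ∀ i : Fin 8, 
      ∀ j, digits (1 <<< (3 * (i : ℕ))) j = if j = i then 1 else 0 := by decide +kernel
    funext j
    rw [h1, h, Pi.single_apply]
  · refine List.mem_map.2 ⟨_, h1, ?_⟩
    funext j
    rw [h2 j (List.mem_finRange j)]
    split_ifs with hj
    · subst hj; rw [refl_apply_self]
    · rw [refl_apply_of_ne hj]

lemma posRoots_nodup : posRoots.Nodup := by
  refine List.Nodup.map_on ?_ (by decide +kernel)
  have h : ∀ n ∈ rootCodes,
      ((List.finRange 8).map fun j => digits n j * 8 ^ (j : ℕ)).sum = n := by decide +kernel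
  intro m hm n hn hmn
  have := h m hm
  rw [hmn, h n hn] at this
  exact_mod_cast this.symm

lemma nonneg_of_mem_posRoots {v : Fin 8 → ℤ} (hv : v ∈ posRoots) : 0 ≤ v := by
  obtain ⟨n, hn, rfl⟩ := List.mem_map.1 hv
  intro j
  exact Int.natCast_nonneg _

lemma ne_zero_of_mem_posRoots {v : Fin 8 → ℤ} (hv : v ∈ posRoots) : v ≠ 0 := by
  obtain ⟨n, hn, rfl⟩ := List.mem_map.1 hv
  have h : ∀ n ∈ rootCodes, ∃ j, digits n j ≠ 0 := by decide +kernel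
  obtain ⟨j, hj⟩ := h n hn
  exact fun h0 => hj (congrFun h0 j)

/-- The quadratic form of type `E₈` is positive definite. -/
lemma exists_pair_pos {v : Fin 8 → ℤ} (h0 : 0 ≤ v) (hv : v ≠ 0) :
    ∃ i, 0 < v i ∧ 0 < pair i v := by
  by_contra! hcon
  have h1 : ∑ i, v i * pair i v ≤ 0 := Finset.sum_nonpos fun i _ => by
    rcases (h0 i).lt_or_eq with h | h
    · exact mul_nonpos_of_nonneg_of_nonpos (h0 i) (hcon i h)
    · rw [← h]; simp
  have h2 : 60 * ∑ i, v i * pair i v = 30 * (2 * v 0 - v 2) ^ 2 + 10 * (3 * v 2 - 2 * v 3) ^ 2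
      + 30 * (2 * v 1 - v 3) ^ 2 + 30 * (2 * v 7 - v 6) ^ 2 + 10 * (3 * v 6 - 2 * v 5) ^ 2
      + 5 * (4 * v 5 - 3 * v 4) ^ 2 + 3 * (5 * v 4 - 4 * v 3) ^ 2 + 2 * (v 3) ^ 2 := by
    simp only [Fin.sum_univ_eight, pair_eq, nbrs]
    simp
    ring
  have h3 : v 3 = 0 := by
    by_contra h
    have := sq_nonneg (v 3)
    have : 0 < (v 3) ^ 2 := by positivity
    linarith [sq_nonneg (2 * v 0 - v 2), sq_nonneg (3 * v 2 - 2 * v 3), sq_nonneg (2 * v 1 - v 3),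
      sq_nonneg (2 * v 7 - v 6), sq_nonneg (3 * v 6 - 2 * v 5), sq_nonneg (4 * v 5 - 3 * v 4),
      sq_nonneg (5 * v 4 - 4 * v 3)]
  have aux : ∀ a b c d e f g : ℤ, 30 * a ^ 2 + 10 * b ^ 2 + 30 * c ^ 2 + 30 * d ^ 2 + 10 * e ^ 2
      + 5 * f ^ 2 + 3 * g ^ 2 ≤ 0 → a = 0 ∧ b = 0 ∧ c = 0 ∧ d = 0 ∧ e = 0 ∧ f = 0 ∧ g = 0 := by
    intro a b c d e f g h
    refine ⟨?_, ?_, ?_, ?_, ?_, ?_, ?_⟩ <;> refine pow_eq_zero_iff (two_ne_zero) |>.1 ?_ <;>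
    linarith [sq_nonneg a, sq_nonneg b, sq_nonneg c, sq_nonneg d, sq_nonneg e, sq_nonneg f,
      sq_nonneg g]
  obtain ⟨a, b, c, d, e, f, g⟩ := aux _ _ _ _ _ _ _ (by
    rw [h3] at h2; rw [h3]; linarith : 30 * (2 * v 0 - v 2) ^ 2 + 10 * (3 * v 2 - 2 * v 3) ^ 2
      + 30 * (2 * v 1 - v 3) ^ 2 + 30 * (2 * v 7 - v 6) ^ 2 + 10 * (3 * v 6 - 2 * v 5) ^ 2
      + 5 * (4 * v 5 - 3 * v 4) ^ 2 + 3 * (5 * v 4 - 4 * v 3) ^ 2 ≤ 0)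
  apply hv
  funext i
  fin_cases i <;> simp <;> omega

end SerreE8

namespace SerreE8

open Module LieAlgebra

lemma end_two_apply {V : Type*} [AddCommGroup V] [Module ℂ V] (x : V) :
    (2 : End ℂ V) x = (2 : ℂ) • x := by
  rw [← one_add_one_eq_two, LinearMap.add_apply, two_smul]; rfl

lemma end_four_apply {V : Type*} [AddCommGroup V] [Module ℂ V] (x : V) :
    (4 : End ℂ V) x = (4 : ℂ) • x := by
  have : (4 : End ℂ V) = 2 + 2 := by norm_num
  rw [this, LinearMap.add_apply, end_two_apply]; module

/-- Three endomorphisms satisfying the commutation relations of `sl₂`. -/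
structure Sl2Ops {V : Type*} [AddCommGroup V] [Module ℂ V] (h e f : End ℂ V) : Prop where
  h_e : h * e = e * h + 2 * e
  h_f : h * f = f * h - 2 * f
  e_f : e * f = f * e + h

namespace Sl2Ops

variable {V : Type*} [AddCommGroup V] [Module ℂ V] {h e f : End ℂ V} (S : Sl2Ops h e f)

/-- The Casimir operator. -/
def casimir (h e f : End ℂ V) : End ℂ V := 4 * (f * e) + h * h + 2 * h

include S

lemma symm : Sl2Ops (-h) f e where
  h_e := by rw [neg_mul, S.h_f]; noncomm_ring
  h_f := by rw [neg_mul, S.h_e]; noncomm_ring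
  e_f := by rw [S.e_f]; abel

lemma casimir_symm : casimir (-h) f e = casimir h e f := by
  simp only [casimir, S.e_f]; noncomm_ring

lemma commute_e : Commute (casimir h e f) e := by
  have h1 : h * (h * e) = e * h * h + 4 * (e * h) + 4 * e := by
    rw [S.h_e, mul_add, ← mul_assoc, S.h_e]
    have : h * (2 * e) = 2 * (h * e) := by noncomm_ring
    rw [this, S.h_e]; noncomm_ring
  have h2 : e * (f * e) = f * e * e + e * h + 2 * e := by
    rw [← mul_assoc, S.e_f, add_mul, S.h_e]; noncomm_ring
  have h3 : casimir h e f * e = 4 * (f * e * e) + h * (h * e) + 2 * (h * e) := by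
    rw [casimir]; noncomm_ring
  have h4 : e * casimir h e f = 4 * (e * (f * e)) + e * h * h + 2 * (e * h) := by
    rw [casimir]; noncomm_ring
  rw [Commute, SemiconjBy, h3, h4, h1, h2, S.h_e]; noncomm_ring

lemma commute_f : Commute (casimir h e f) f := by
  rw [← S.casimir_symm]; exact S.symm.commute_e

lemma commute_h : Commute (casimir h e f) h := by
  have : casimir h e f * h - h * casimir h e f = 0 := by
    have h1 : h * (f * e) = f * e * h := by
      rw [← mul_assoc, S.h_f, sub_mul, mul_assoc f, S.h_e]; noncomm_ring
    have h2 : casimir h e f * h - h * casimir h e f = 4 * (f * e * h) - 4 * (h * (f * e)) := by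
      rw [casimir]; noncomm_ring
    rw [h2, h1, sub_self]
  exact sub_eq_zero.1 this

lemma h_e_apply {μ : ℂ} {v : V} (hv : h v = μ • v) : h (e v) = (μ + 2) • e v := by
  have := LinearMap.congr_fun S.h_e v
  simp only [Module.End.mul_apply, LinearMap.add_apply, hv, map_smul] at this
  rw [this, add_smul, end_two_apply]

lemma h_f_apply {μ : ℂ} {v : V} (hv : h v = μ • v) : h (f v) = (μ - 2) • f v := by
  have := S.symm.h_e_apply (μ := -μ) (v := v) (by simp [hv])
  rw [LinearMap.neg_apply, neg_eq_iff_eq_neg] at this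
  rw [this, ← neg_smul]; congr 1; ring

lemma h_e_pow_apply {μ : ℂ} {v : V} (hv : h v = μ • v) (n : ℕ) :
    h ((e ^ n) v) = (μ + 2 * n) • (e ^ n) v := by
  induction n with
  | zero => simp [hv]
  | succ n ih =>
    rw [pow_succ', Module.End.mul_apply, S.h_e_apply ih]; congr 1; push_cast; ring

lemma h_f_pow_apply {μ : ℂ} {v : V} (hv : h v = μ • v) (n : ℕ) :
    h ((f ^ n) v) = (μ - 2 * n) • (f ^ n) v := by
  induction n with
  | zero => simp [hv]
  | succ n ih =>
    rw [pow_succ', Module.End.mul_apply, S.h_f_apply ih]; congr 1; push_cast; ring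

omit S in
lemma casimir_apply_of_e_eq_zero {μ : ℂ} {v : V} (hv : h v = μ • v) (hev : e v = 0) :
    casimir h e f v = (μ ^ 2 + 2 * μ) • v := by
  simp only [casimir, LinearMap.add_apply, Module.End.mul_apply, hev, map_zero, hv, map_smul, end_two_apply,
    zero_add]
  module

lemma e_f_apply {μ c : ℂ} {v : V} (hv : h v = μ • v) (hc : casimir h e f v = c • v) :
    (4 : ℂ) • e (f v) = (c - μ ^ 2 + 2 * μ) • v := by
  rw [← S.casimir_symm] at hc
  simp only [casimir, LinearMap.add_apply, Module.End.mul_apply, LinearMap.neg_apply, hv, map_smul,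
    end_two_apply, end_four_apply, map_neg] at hc
  have : (4 : ℂ) • e (f v) = c • v - (μ • μ • v - (2 : ℂ) • μ • v) := by
    rw [← hc]; module
  rw [this]; module

/-- If `f` is locally nilpotent then `e ^ n` is injective on the weight space of weight `-n`. -/
lemma eq_zero_of_e_pow_eq_zero (hf : ∀ v, ∃ k, (f ^ k) v = 0) {n k : ℕ} (hk : k ≤ n) {v : V}
    (hv : h v = (-n : ℂ) • v) (hev : (e ^ k) v = 0) : v = 0 := by
  induction k generalizing v with
  | zero => simpa using hev
  | succ k ih =>
    set c : ℂ := ((-n : ℂ) + 2 * k) ^ 2 + 2 * ((-n : ℂ) + 2 * k) with hc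
    have h1 : casimir h e f ((e ^ k) v) = c • (e ^ k) v :=
      casimir_apply_of_e_eq_zero (S.h_e_pow_apply hv k) (by
        rw [← Module.End.mul_apply, ← pow_succ', hev])
    have h2 : casimir h e f v - c • v = 0 := by
      refine ih (by omega) ?_ ?_
      · rw [map_sub, map_smul, ← Module.End.mul_apply, ← S.commute_h.eq, Module.End.mul_apply, hv]
        simp only [map_smul]; module
      · rw [map_sub, map_smul, ← Module.End.mul_apply, ← (S.commute_e.pow_right k).eq,
          Module.End.mul_apply, h1, sub_self]
    have hcv : casimir h e f v = c • v := sub_eq_zero.1 h2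
    obtain ⟨m, hm⟩ := hf v
    induction m with
    | zero => simpa using hm
    | succ m ihm =>
      apply ihm
      have h3 := S.e_f_apply (S.h_f_pow_apply hv m) (c := c) (by
        rw [← Module.End.mul_apply, (S.commute_f.pow_right m).eq, Module.End.mul_apply, hcv,
          map_smul])
      rw [← Module.End.mul_apply f, ← pow_succ', hm, map_zero, smul_zero] at h3
      refine (smul_eq_zero.1 h3.symm).resolve_left ?_
      have hfac : c - ((-n : ℂ) - 2 * m) ^ 2 + 2 * ((-n : ℂ) - 2 * m)
          = -(((4 * (m + k + 1) * (n + m - k) : ℤ)) : ℂ) := by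
        rw [hc]; push_cast; ring
      rw [hfac, neg_eq_zero, Int.cast_eq_zero]
      refine ne_of_gt ?_
      have : (0 : ℤ) < n + m - k := by omega
      positivity

end Sl2Ops

lemma sl2Ops_ad {L : Type*} [LieRing L] [LieAlgebra ℂ L] {h e f : L} (hhe : ⁅h, e⁆ = (2 : ℂ) • e)
    (hhf : ⁅h, f⁆ = (-2 : ℂ) • f) (hef : ⁅e, f⁆ = h) :
    Sl2Ops (ad ℂ L h) (ad ℂ L e) (ad ℂ L f) where
  h_e := by
    ext x
    simp [leibniz_lie h, hhe]; module
  h_f := by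
    ext x
    simp [leibniz_lie h, hhf]; module
  e_f := by
    ext x
    simp [leibniz_lie e, hef]; abel

end SerreE8

namespace SerreE8

open Module LieAlgebra

variable {L : Type*} [LieRing L] [LieAlgebra ℂ L]

namespace IsSerreSystem

variable {H E F : Fin 8 → L} (hS : IsSerreSystem H E F)
include hS

lemma sl2Ops (i : Fin 8) : Sl2Ops (ad ℂ L (H i)) (ad ℂ L (E i)) (ad ℂ L (F i)) :=
  sl2Ops_ad (by simp [hS.lie_h_e]) (by simp [hS.lie_h_f]) (hS.lie_e_f_same i)

lemma ad_e_locally_nilpotent (i : Fin 8) (x : L) : ∃ n, (ad ℂ L (E i) ^ n) x = 0 := by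
  suffices h : LieSubalgebra.engel ℂ (E i) = ⊤ by
    rw [← LieSubalgebra.mem_engel_iff, h]; trivial
  refine hS.eq_top _ (fun j => ?_) (fun j => ?_) <;> rw [LieSubalgebra.mem_engel_iff]
  · exact ⟨_, by rw [pow_succ, Module.End.mul_apply]; exact hS.ad_e i j⟩
  · rcases eq_or_ne i j with rfl | h
    · refine ⟨3, ?_⟩
      have : ⁅E i, H i⁆ = -((2 : ℂ) • E i) := by rw [← lie_skew, hS.lie_h_e]; simp
      simp [pow_succ, hS.lie_e_f_same, this]
    · exact ⟨1, by simp [hS.lie_e_f_ne i j h]⟩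

lemma exists_reflection_of_nonpos {i : Fin 8} {v : Fin 8 → ℤ} (hv : pair i v ≤ 0) :
    ∃ g : L →ₗ[ℂ] L, (∀ x ∈ wtSpace H v, g x ∈ wtSpace H (refl i v)) ∧
      (∀ x ∈ wtSpace H v, g x = 0 → x = 0) ∧ ∀ I : LieIdeal ℂ L, ∀ x ∈ I, g x ∈ I := by
  obtain ⟨n, hn⟩ := Int.exists_eq_neg_ofNat hv
  refine ⟨ad ℂ L (E i) ^ n, fun x hx => ?_, fun x hx h0 => ?_, fun I x hx => ?_⟩
  · have hw : refl i v = (n : ℤ) • Pi.single i 1 + v := by rw [refl, hn, neg_smul]; abel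
    rw [hw]
    clear hw hn
    induction n with
    | zero => simpa using hx
    | succ n ih =>
      rw [pow_succ', Module.End.mul_apply, ad_apply]
      have := lie_mem (hS.e_mem i) ih
      rwa [← add_assoc, ← one_add_zsmul, add_comm 1] at this
  · refine (hS.sl2Ops i).eq_zero_of_e_pow_eq_zero (hS.symm.ad_e_locally_nilpotent i)
      (le_refl n) ?_ h0
    rw [ad_apply, hS.lie_h hx, hn]; simp
  · clear hn
    induction n with
    | zero => simpa using hx
    | succ n ih =>
      rw [pow_succ', Module.End.mul_apply, ad_apply]
      exact lie_mem_right ℂ L I _ _ ih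

lemma exists_reflection (i : Fin 8) (v : Fin 8 → ℤ) :
    ∃ g : L →ₗ[ℂ] L, (∀ x ∈ wtSpace H v, g x ∈ wtSpace H (refl i v)) ∧
      (∀ x ∈ wtSpace H v, g x = 0 → x = 0) ∧ ∀ I : LieIdeal ℂ L, ∀ x ∈ I, g x ∈ I := by
  rcases le_total (pair i v) 0 with h | h
  · exact hS.exists_reflection_of_nonpos h
  · have := hS.symm.exists_reflection_of_nonpos (i := i) (v := -v) (by rw [pair_neg]; omega)
    simpa only [wtSpace_neg, refl_neg, neg_neg] using this

lemma wtSpace_refl_ne_bot {i : Fin 8} {v : Fin 8 → ℤ} (h : wtSpace H v ≠ ⊥) :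
    wtSpace H (refl i v) ≠ ⊥ := by
  obtain ⟨g, h1, h2, -⟩ := hS.exists_reflection i v
  obtain ⟨x, hx, hx0⟩ := Submodule.exists_mem_ne_zero_of_ne_bot h
  exact fun h0 => hx0 (h2 x hx (by simpa [h0] using h1 x hx))

/-- Nonzero weight spaces of positive weight are attached to positive roots, and are lines. -/
lemma mem_posRoots_and_line {v : Fin 8 → ℤ} (h0 : 0 ≤ v) (hv : v ≠ 0) (h : wtSpace H v ≠ ⊥) :
    v ∈ posRoots ∧ ∃ x, wtSpace H v ≤ Submodule.span ℂ {x} := by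
  obtain ⟨N, hN⟩ : ∃ N : ℕ, ∑ i, v i < N := ⟨(∑ i, v i).toNat + 1, by omega⟩
  induction N generalizing v with
  | zero =>
    have : 0 ≤ ∑ i, v i := Finset.sum_nonneg fun i _ => h0 i
    omega
  | succ N ih =>
    obtain ⟨i, hi, hp⟩ := exists_pair_pos h0 hv
    rcases hS.nonneg_or_nonpos (hS.wtSpace_refl_ne_bot (i := i) h) with hr | hr
    · have hr0 : refl i v ≠ 0 := fun h0 => hv (by rw [← refl_refl i v, h0]; simp [refl, pair_zero])
      obtain ⟨hmem, x, hx⟩ := ih hr hr0 (hS.wtSpace_refl_ne_bot h) (by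
        have : ∑ j, refl i v j = ∑ j, v j - pair i v := by
          simp [refl, Finset.sum_sub_distrib, ← Finset.mul_sum]
        push_cast at hN
        omega)
      have hne : refl i v ≠ Pi.single i 1 := fun he => by
        have := pair_refl i v
        rw [he, pair_single_self] at this
        omega
      refine ⟨refl_refl i v ▸ refl_mem_posRoots hmem i hne, ?_⟩
      obtain ⟨g, h1, h2, -⟩ := hS.exists_reflection i v
      obtain ⟨y, hy, hy0⟩ := Submodule.exists_mem_ne_zero_of_ne_bot h
      refine ⟨y, fun z hz => ?_⟩
      obtain ⟨a, ha⟩ := Submodule.mem_span_singleton.1 (hx (h1 y hy))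
      obtain ⟨b, hb⟩ := Submodule.mem_span_singleton.1 (hx (h1 z hz))
      have ha0 : a ≠ 0 := fun ha0 => hy0 (h2 y hy (by rw [← ha, ha0, zero_smul]))
      refine Submodule.mem_span_singleton.2 ⟨b / a, ?_⟩
      refine (sub_eq_zero.1 (h2 _ (sub_mem hz (Submodule.smul_mem _ (b / a) hy)) ?_)).symm
      rw [map_sub, map_smul, ← ha, ← hb, smul_smul, div_mul_cancel₀ _ ha0, sub_self]
    · have hvi : v = v i • Pi.single i 1 := by
        funext j
        rcases eq_or_ne j i with rfl | hj
        · simp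
        · have h1 := hr j
          rw [refl_apply_of_ne hj] at h1
          simpa [hj] using le_antisymm h1 (h0 j)
      rw [hvi] at h
      obtain ⟨x, hx, hx0⟩ := Submodule.exists_mem_ne_zero_of_ne_bot h
      have hi1 : v i = 1 := ((hS.wtSpace_single_aux hi hx).resolve_right hx0).1
      rw [hi1, one_smul] at hvi
      refine ⟨hvi ▸ single_mem_posRoots i, E i, fun y hy => ?_⟩
      rw [hvi] at hy
      rcases hS.wtSpace_single_aux (i := i) (k := 1) one_pos (by simpa using hy) with h | h
      · exact h.2
      · rw [h]; exact zero_mem _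

/-- Every positive root comes with a family of operators relating its weight space to the one of a
simple root. -/
lemma exists_transport {v : Fin 8 → ℤ} (hv : v ∈ posRoots) :
    ∃ i, ∃ g g' : L →ₗ[ℂ] L,
      (∀ x ∈ wtSpace H v, g x ∈ wtSpace H (Pi.single i 1)) ∧
      (∀ x ∈ wtSpace H v, g x = 0 → x = 0) ∧ (∀ I : LieIdeal ℂ L, ∀ x ∈ I, g x ∈ I) ∧
      (∀ x ∈ wtSpace H (Pi.single i 1), g' x ∈ wtSpace H v) ∧
      (∀ x ∈ wtSpace H (Pi.single i 1), g' x = 0 → x = 0) := by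
  obtain ⟨N, hN⟩ : ∃ N : ℕ, ∑ i, v i < N := ⟨(∑ i, v i).toNat + 1, by omega⟩
  induction N generalizing v with
  | zero =>
    have : 0 ≤ ∑ i, v i := Finset.sum_nonneg fun i _ => nonneg_of_mem_posRoots hv i
    omega
  | succ N ih =>
    obtain ⟨i, hi, hp⟩ := exists_pair_pos (nonneg_of_mem_posRoots hv) (ne_zero_of_mem_posRoots hv)
    by_cases hvi : v = Pi.single i 1
    · exact ⟨i, LinearMap.id, LinearMap.id, by simp [hvi], by simp, by simp, by simp [hvi],
        by simp⟩
    · obtain ⟨j, g, g', h1, h2, h3, h4, h5⟩ := ih (refl_mem_posRoots hv i hvi) (by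
        have : ∑ j, refl i v j = ∑ j, v j - pair i v := by
          simp [refl, Finset.sum_sub_distrib, ← Finset.mul_sum]
        push_cast at hN
        omega)
      obtain ⟨r, hr1, hr2, hr3⟩ := hS.exists_reflection i v
      obtain ⟨r', hr1', hr2', -⟩ := hS.exists_reflection i (refl i v)
      rw [refl_refl] at hr1'
      exact ⟨j, g ∘ₗ r, r' ∘ₗ g', fun x hx => h1 _ (hr1 x hx),
        fun x hx h0 => hr2 x hx (h2 _ (hr1 x hx) h0), fun I x hx => h3 I _ (hr3 I x hx),
        fun x hx => hr1' _ (h4 x hx), fun x hx h0 => h5 x hx (hr2' _ (h4 x hx) h0)⟩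

end IsSerreSystem

end SerreE8

namespace SerreE8

open Module LieAlgebra

lemma eigenspace_eq_maxGenEigenspace {V : Type*} [AddCommGroup V] [Module ℂ V] {g : End ℂ V}
    (h : ⨆ μ, g.eigenspace μ = ⊤) (μ : ℂ) : g.eigenspace μ = g.maxGenEigenspace μ :=
  congrFun (((Module.End.independent_maxGenEigenspace g).le_iff_eq_of_iSup_eq_top h).1
    fun μ => (g.genEigenspace μ).monotone le_top) μ

variable {L : Type*} [LieRing L] [LieAlgebra ℂ L]

/-- The set of all roots. -/
def rootFinset : Finset (Fin 8 → ℤ) := posRoots.toFinset ∪ posRoots.toFinset.image (-·)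

lemma mem_rootFinset {v : Fin 8 → ℤ} : v ∈ rootFinset ↔ v ∈ posRoots ∨ -v ∈ posRoots := by
  simp [rootFinset, neg_eq_iff_eq_neg]

lemma single_mem_rootFinset (j : Fin 8) : Pi.single j 1 ∈ rootFinset :=
  mem_rootFinset.2 (Or.inl (single_mem_posRoots j))

lemma ne_zero_of_mem_rootFinset {v : Fin 8 → ℤ} (hv : v ∈ rootFinset) : v ≠ 0 := by
  rintro rfl
  rcases mem_rootFinset.1 hv with h | h
  · exact ne_zero_of_mem_posRoots h rfl
  · exact ne_zero_of_mem_posRoots h neg_zero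

lemma eq_zero_of_forall_pair_eq_zero {c : Fin 8 → ℂ}
    (h : ∀ j, ∑ i, c i * (CartanMatrix.E₈ i j : ℂ) = 0) : c = 0 := by
  have hdet : ((CartanMatrix.E₈).map (Int.castRingHom ℂ)).det ≠ 0 := by
    rw [← RingHom.mapMatrix_apply, ← RingHom.map_det, CartanMatrix.E₈_det]; simp
  refine Matrix.eq_zero_of_vecMul_eq_zero hdet ?_
  funext j
  exact h j

namespace IsSerreSystem

variable {H E F : Fin 8 → L} (hS : IsSerreSystem H E F)
include hS

lemma mem_rootFinset_and_line {v : Fin 8 → ℤ} (hv : v ≠ 0) (h : wtSpace H v ≠ ⊥) :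
    v ∈ rootFinset ∧ ∃ x, wtSpace H v ≤ Submodule.span ℂ {x} := by
  rcases hS.nonneg_or_nonpos h with h0 | h0
  · have := hS.mem_posRoots_and_line h0 hv h
    exact ⟨mem_rootFinset.2 (Or.inl this.1), this.2⟩
  · have := hS.symm.mem_posRoots_and_line (v := -v) (by simpa using h0) (by simpa using hv)
      (by rwa [wtSpace_neg, neg_neg])
    rw [wtSpace_neg, neg_neg] at this
    exact ⟨mem_rootFinset.2 (Or.inr this.1), this.2⟩

lemma iSup_mem_rootFinset : ⨆ v ∈ insert 0 rootFinset, wtSpace H v = ⊤ := by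
  rw [eq_top_iff, ← hS.iSup_wtSpace]
  refine iSup_le fun v => ?_
  by_cases h : wtSpace H v = ⊥
  · rw [h]; exact bot_le
  · refine le_iSup₂_of_le v ?_ le_rfl
    rw [Finset.mem_insert, or_iff_not_imp_left]
    exact fun hv => (hS.mem_rootFinset_and_line hv h).1

lemma finiteDimensional : FiniteDimensional ℂ L := by
  have h1 : ∀ v, FiniteDimensional ℂ (wtSpace H v) := by
    intro v
    by_cases hv : v = 0
    · subst hv
      rw [hS.wtSpace_zero]
      exact FiniteDimensional.span_of_finite ℂ (Set.finite_range H)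
    by_cases h : wtSpace H v = ⊥
    · rw [h]; infer_instance
    · obtain ⟨x, hx⟩ := (hS.mem_rootFinset_and_line hv h).2
      have := FiniteDimensional.span_singleton ℂ x
      exact Submodule.finiteDimensional_of_le hx
  have h2 : FiniteDimensional ℂ (⊤ : Submodule ℂ L) := by
    have h3 := hS.iSup_mem_rootFinset
    generalize insert 0 rootFinset = s at h3
    rw [← h3, ← Finset.sup_eq_iSup]
    exact Submodule.finiteDimensional_finset_sup _ _
  exact Module.finite_def.2 ((Submodule.fg_top ⊤).1 (Module.finite_def.1 h2))

lemma e_ne_zero [Nontrivial L] (i : Fin 8) : E i ≠ 0 := by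
  intro h0
  have step : ∀ i j, CartanMatrix.E₈ i j ≠ 0 → E i = 0 → E j = 0 := by
    intro i j hij h
    have hH : H i = 0 := by rw [← hS.lie_e_f_same, h, zero_lie]
    have := hS.lie_h_e i j
    rw [hH, zero_lie] at this
    exact (smul_eq_zero.1 this.symm).resolve_left (by exact_mod_cast hij)
  have all : ∀ j, E j = 0 := by
    have conn : ∀ i j : Fin 8, Relation.ReflTransGen (fun a b => CartanMatrix.E₈ a b ≠ 0) i j := by
      have to3 : ∀ i : Fin 8, Relation.ReflTransGen (fun a b => CartanMatrix.E₈ a b ≠ 0) i 3 ∧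
          Relation.ReflTransGen (fun a b => CartanMatrix.E₈ a b ≠ 0) 3 i := by
        have s : ∀ a b : Fin 8, CartanMatrix.E₈ a b ≠ 0 →
            (Relation.ReflTransGen (fun a b => CartanMatrix.E₈ a b ≠ 0) b 3 ∧
              Relation.ReflTransGen (fun a b => CartanMatrix.E₈ a b ≠ 0) 3 b) →
            (Relation.ReflTransGen (fun a b => CartanMatrix.E₈ a b ≠ 0) a 3 ∧
              Relation.ReflTransGen (fun a b => CartanMatrix.E₈ a b ≠ 0) 3 a) := fun a b h h' =>
          ⟨h'.1.head h, h'.2.tail (by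
            rwa [← Matrix.transpose_apply CartanMatrix.E₈, CartanMatrix.E₈_transpose])⟩
        have h3 := s 3 3 (by decide) ⟨.refl, .refl⟩
        have h2 := s 2 3 (by decide) h3
        have h4 := s 4 3 (by decide) h3
        have h5 := s 5 4 (by decide) h4
        have h6 := s 6 5 (by decide) h5
        have h7 := s 7 6 (by decide) h6
        intro i
        fin_cases i
        exacts [s 0 2 (by decide) h2, s 1 3 (by decide) h3, h2, h3, h4, h5, h6, h7]
      exact fun i j => (to3 i).1.trans (to3 j).2
    intro j
    induction conn i j with
    | refl => exact h0
    | tail _ h ih => exact step _ _ h ih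
  have hF : ∀ j, F j = 0 := by
    intro j
    have hH : H j = 0 := by rw [← hS.lie_e_f_same, all, zero_lie]
    have := hS.lie_h_f j j
    rw [hH, zero_lie] at this
    exact (smul_eq_zero.1 this.symm).resolve_left (by simp)
  have := hS.eq_top ⊥ (fun j => by simp [all]) (fun j => by simp [hF])
  obtain ⟨x, hx⟩ := exists_ne (0 : L)
  have h2 : x ∈ (⊥ : LieSubalgebra ℂ L) := by rw [this]; trivial
  exact hx (by simpa using h2)

lemma eq_zero_of_sum_commute [Nontrivial L] {c : Fin 8 → ℂ}
    (h : ∀ j, ⁅∑ i, c i • H i, E j⁆ = 0) : c = 0 := by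
  refine eq_zero_of_forall_pair_eq_zero fun j => ?_
  have := h j
  simp only [sum_lie, smul_lie, hS.lie_h_e, smul_smul, ← Finset.sum_smul] at this
  exact (smul_eq_zero.1 this).resolve_right (hS.e_ne_zero j)

lemma linearIndependent_h [Nontrivial L] : LinearIndependent ℂ H := by
  rw [Fintype.linearIndependent_iff]
  intro c hc
  have := hS.eq_zero_of_sum_commute (c := c) (fun j => by rw [hc, zero_lie])
  exact fun i => congrFun this i

lemma finrank_wtSpace_zero [Nontrivial L] : finrank ℂ (wtSpace H 0) = 8 := by
  rw [hS.wtSpace_zero, finrank_span_eq_card hS.linearIndependent_h, Fintype.card_fin]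

lemma wtSpace_ne_bot [Nontrivial L] {v : Fin 8 → ℤ} (hv : v ∈ rootFinset) :
    wtSpace H v ≠ ⊥ := by
  rcases mem_rootFinset.1 hv with h | h
  · obtain ⟨i, g, g', -, -, -, h4, h5⟩ := hS.exists_transport h
    intro hbot
    refine hS.e_ne_zero i (h5 _ (hS.e_mem i) ?_)
    simpa [hbot] using h4 _ (hS.e_mem i)
  · obtain ⟨i, g, g', -, -, -, h4, h5⟩ := hS.symm.exists_transport h
    simp only [wtSpace_neg, neg_neg] at h4
    intro hbot
    refine hS.symm.e_ne_zero i (h5 _ (hS.symm.e_mem i) ?_)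
    have := h4 _ (wtSpace_neg H _ ▸ hS.symm.e_mem i)
    simpa [hbot] using this

lemma finrank_wtSpace [Nontrivial L] {v : Fin 8 → ℤ} (hv : v ∈ rootFinset) :
    finrank ℂ (wtSpace H v) = 1 := by
  have h := hS.wtSpace_ne_bot hv
  obtain ⟨x, hx⟩ := (hS.mem_rootFinset_and_line (ne_zero_of_mem_rootFinset hv) h).2
  have := FiniteDimensional.span_singleton ℂ x
  have := Submodule.finiteDimensional_of_le hx
  have h1 := (Submodule.finrank_mono hx).trans (finrank_span_le_card _)
  have h2 := Submodule.one_le_finrank_iff.2 h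
  simp at h1
  omega

lemma iSup_eigenspace : ⨆ μ, (ad ℂ L (sepElt H)).eigenspace μ = ⊤ := by
  rw [eq_top_iff, ← hS.iSup_wtSpace]
  exact iSup_le fun v => le_iSup _ (sepEval v)

lemma eigenspace_eq_bot {μ : ℂ} (h : μ ∉ Set.range sepEval) :
    (ad ℂ L (sepElt H)).eigenspace μ = ⊥ := by
  have := Module.End.eigenspaces_iSupIndep (ad ℂ L (sepElt H)) μ
  refine disjoint_self.1 (this.mono_right ?_)
  refine le_top.trans (hS.iSup_wtSpace ▸ iSup_le fun v => ?_)
  exact le_iSup₂_of_le (sepEval v) (fun h' => h ⟨v, h'⟩) le_rfl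

lemma inf_wtSpace_single_eq_bot {I : LieIdeal ℂ L} (hI : IsLieAbelian I) {i : Fin 8} {x : L}
    (hx : x ∈ I) (hx' : x ∈ wtSpace H (Pi.single i 1)) : x = 0 := by
  rcases hS.wtSpace_single_aux (i := i) (k := 1) one_pos (by simpa using hx') with ⟨-, h⟩ | h
  · obtain ⟨a, rfl⟩ := Submodule.mem_span_singleton.1 h
    by_cases ha : a = 0
    · rw [ha, zero_smul]
    have hE : E i ∈ I := by
      have := I.smul_mem a⁻¹ hx
      rwa [smul_smul, inv_mul_cancel₀ ha, one_smul] at this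
    have hH : H i ∈ I := by
      rw [← hS.lie_e_f_same]
      exact lie_mem_left ℂ L I _ _ hE
    have := congrArg Subtype.val (hI.trivial ⟨H i, hH⟩ ⟨E i, hE⟩)
    have h2 : ⁅H i, E i⁆ = 0 := this
    rw [hS.lie_h_e] at h2
    rw [(smul_eq_zero.1 h2).resolve_left (by simp), smul_zero]
  · exact h

lemma hasTrivialRadical [Nontrivial L] : HasTrivialRadical ℂ L := by
  rw [hasTrivialRadical_iff_no_abelian_ideals]
  intro I hI
  have := hS.finiteDimensional
  have hpos : ∀ v ∈ rootFinset, ∀ x ∈ I, x ∈ wtSpace H v → x = 0 := by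
    intro v hv x hx hxv
    rcases mem_rootFinset.1 hv with h | h
    · obtain ⟨i, g, -, h1, h2, h3, -⟩ := hS.exists_transport h
      exact h2 x hxv (hS.inf_wtSpace_single_eq_bot hI (h3 I x hx) (h1 x hxv))
    · obtain ⟨i, g, -, h1, h2, h3, -⟩ := hS.symm.exists_transport h
      have hxv' : x ∈ wtSpace (-H) (-v) := by rwa [wtSpace_neg, neg_neg]
      exact h2 x hxv' (hS.symm.inf_wtSpace_single_eq_bot hI (h3 I x hx) (h1 x hxv'))
  have h0 : ∀ x ∈ I, x ∈ wtSpace H 0 → x = 0 := by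
    intro x hx hx0
    have hcomm : ∀ j, ⁅x, E j⁆ = 0 := by
      intro j
      have h1 := lie_mem hx0 (hS.e_mem j)
      rw [zero_add] at h1
      exact hpos _ (single_mem_rootFinset j) _ (lie_mem_left ℂ L I _ _ hx) h1
    rw [hS.wtSpace_zero, Submodule.mem_span_range_iff_exists_fun] at hx0
    obtain ⟨c, rfl⟩ := hx0
    rw [hS.eq_zero_of_sum_commute hcomm]; simp
  have hdec := Submodule.eq_iSup_inf_genEigenspace (p := I.toSubmodule) (f := ad ℂ L (sepElt H)) 1
    (fun x hx => lie_mem_right ℂ L I _ _ hx) hS.iSup_eigenspace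
  have hbot : I.toSubmodule = ⊥ := by
    rw [hdec, iSup_eq_bot]
    intro μ
    rw [Submodule.eq_bot_iff]
    rintro x ⟨hx, hxμ⟩
    by_cases hμ : μ ∈ Set.range sepEval
    · obtain ⟨v, rfl⟩ := hμ
      by_cases hv : v = 0
      · subst hv; exact h0 x hx hxμ
      by_contra hx0
      have : wtSpace H v ≠ ⊥ := fun h => hx0 (by
        have : x ∈ wtSpace H v := hxμ
        simpa [h] using this)
      exact hx0 (hpos v (hS.mem_rootFinset_and_line hv this).1 x hx hxμ)
    · have : x ∈ (ad ℂ L (sepElt H)).eigenspace μ := hxμ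
      rw [hS.eigenspace_eq_bot hμ] at this
      simpa using this
  simpa using hbot

lemma isKilling [Nontrivial L] : IsKilling ℂ L := by
  have := hS.finiteDimensional
  have := hS.hasTrivialRadical
  infer_instance

end IsSerreSystem

end SerreE8

namespace SerreE8

open Module LieAlgebra CartanMatrix

/-- The generators of the free Lie algebra satisfy the Serre relations in a quotient which kills
these relations. -/
lemma isSerreSystem_of_surjective {L : Type*} [LieRing L] [LieAlgebra ℂ L]
    (π : FreeLieAlgebra ℂ (Generators (Fin 8)) →ₗ⁅ℂ⁆ L) (hπ : Function.Surjective π)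
    (h : ∀ x ∈ Relations.toSet ℂ CartanMatrix.E₈, π x = 0) :
    IsSerreSystem (fun i => π (FreeLieAlgebra.of ℂ (.H i)))
      (fun i => π (FreeLieAlgebra.of ℂ (.E i))) (fun i => π (FreeLieAlgebra.of ℂ (.F i))) := by
  have hpow : ∀ x y (n : ℕ), π ((ad ℂ _ x ^ n) y) = (ad ℂ _ (π x) ^ n) (π y) := by
    intro x y n
    induction n with
    | zero => rfl
    | succ n ih => rw [pow_succ', pow_succ', Module.End.mul_apply, ad_apply, LieHom.map_lie, ih]; rfl
  have hEF : ∀ i j, π (Relations.EF ℂ (i, j)) = 0 := fun i j => h _ (by simp [Relations.toSet])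
  have hHE : ∀ i j, π (Relations.HE ℂ CartanMatrix.E₈ (i, j)) = 0 :=
    fun i j => h _ (by simp [Relations.toSet])
  have hHF : ∀ i j, π (Relations.HF ℂ CartanMatrix.E₈ (i, j)) = 0 :=
    fun i j => h _ (by simp [Relations.toSet])
  have hadE : ∀ i j, π (Relations.adE ℂ CartanMatrix.E₈ (i, j)) = 0 :=
    fun i j => h _ (by simp [Relations.toSet])
  have hadF : ∀ i j, π (Relations.adF ℂ CartanMatrix.E₈ (i, j)) = 0 :=
    fun i j => h _ (by simp [Relations.toSet])
  have hHH : ∀ i j, π (Relations.HH ℂ (i, j)) = 0 := fun i j => h _ (by simp [Relations.toSet])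
  refine ⟨fun i j => ?_, fun i => ?_, fun i j hij => ?_, fun i j => ?_, fun i j => ?_,
    fun i j => ?_, fun i j => ?_, fun S hE hF => ?_⟩
  · simpa [Relations.HH] using hHH i j
  · simpa [Relations.EF, sub_eq_zero] using hEF i i
  · simpa [Relations.EF, hij] using hEF i j
  · have := hHE i j
    simp only [Relations.HE, Function.uncurry, Function.comp_apply, map_sub, LieHom.map_lie,
      map_zsmul, sub_eq_zero] at this
    rw [this, Int.cast_smul_eq_zsmul]
  · have := hHF i j
    simp only [Relations.HF, Function.uncurry, Function.comp_apply, map_add, LieHom.map_lie,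
      map_zsmul, ← eq_neg_iff_add_eq_zero] at this
    rw [this, neg_smul, Int.cast_smul_eq_zsmul]
  · have := hadE i j
    simpa only [Relations.adE, Function.uncurry, Function.comp_apply, hpow, LieHom.map_lie]
      using this
  · have := hadF i j
    simpa only [Relations.adF, Function.uncurry, Function.comp_apply, hpow, LieHom.map_lie]
      using this
  · have hH : ∀ i, π (FreeLieAlgebra.of ℂ (.H i)) ∈ S := by
      intro i
      have := hEF i i
      simp only [Relations.EF, Function.uncurry, Function.comp_apply, if_pos, map_sub,
        LieHom.map_lie, sub_eq_zero] at this
      exact this ▸ S.lie_mem (hE i) (hF i)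
    let g : Generators (Fin 8) → S
      | .H i => ⟨_, hH i⟩
      | .E i => ⟨_, hE i⟩
      | .F i => ⟨_, hF i⟩
    have hg : S.incl.comp (FreeLieAlgebra.lift ℂ g) = π := by
      refine FreeLieAlgebra.hom_ext fun x => ?_
      rw [LieHom.comp_apply, FreeLieAlgebra.lift_of_apply]
      cases x <;> rfl
    rw [eq_top_iff]
    intro x _
    obtain ⟨y, rfl⟩ := hπ x
    rw [← hg]
    exact (FreeLieAlgebra.lift ℂ g y).2

lemma exists_isSerreSystem :
    ∃ H E F : Fin 8 → LieAlgebra.e₈ ℂ, IsSerreSystem H E F := by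
  let π : FreeLieAlgebra ℂ (Generators (Fin 8)) →ₗ⁅ℂ⁆ LieAlgebra.e₈ ℂ :=
    { (LieSubmodule.Quotient.mk' (Relations.toIdeal ℂ CartanMatrix.E₈)).toLinearMap with
      map_lie' := fun {x y} => LieSubmodule.Quotient.mk_bracket _ x y }
  refine ⟨_, _, _, isSerreSystem_of_surjective π
    (LieSubmodule.Quotient.surjective_mk' (Relations.toIdeal ℂ CartanMatrix.E₈))
    fun x hx => ?_⟩
  exact (LieSubmodule.Quotient.mk_eq_zero (N := Relations.toIdeal ℂ CartanMatrix.E₈)).2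
    (LieSubmodule.subset_lieSpan hx)

end SerreE8

namespace SerreE8

open Module

lemma aeval_X_sub_C_apply {V : Type*} [AddCommGroup V] [Module ℂ V] (h : End ℂ V) (c : ℂ) (v : V) :
    (Polynomial.aeval h (Polynomial.X - Polynomial.C c)) v = h v - c • v := by
  simp

lemma apply_eq_smul_of_prod_apply_eq_zero {V : Type*} [AddCommGroup V] [Module ℂ V] {h : End ℂ V}
    {μ : ℂ} (K : ℕ) {v : V} (hv : v ∈ h.maxGenEigenspace μ) (hv0 : v ≠ 0)
    (hK : (Polynomial.aeval h (∏ i ∈ Finset.range K, (Polynomial.X - Polynomial.C (i : ℂ)))) v = 0) :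
    h v = μ • v ∧ ∃ i < K, μ = (i : ℕ) := by
  have key {w : V} (hw : w ∈ h.maxGenEigenspace μ) {c : ℂ} (hc : h w = c • w) (hw0 : w ≠ 0) :
      μ = c := by
    by_contra hne
    have h1 : w ∈ h.maxGenEigenspace c :=
      (h.genEigenspace c).monotone le_top (Module.End.mem_eigenspace_iff.2 hc)
    exact hw0 (Submodule.disjoint_def.1
      ((Module.End.independent_maxGenEigenspace h).pairwiseDisjoint hne) w hw h1)
  have hstab (c : ℂ) {w : V} (hw : w ∈ h.maxGenEigenspace μ) :
      h w - c • w ∈ h.maxGenEigenspace μ :=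
    sub_mem (Module.End.mapsTo_maxGenEigenspace_of_comm (Commute.refl h) μ hw)
      (Submodule.smul_mem _ _ hw)
  induction K generalizing v with
  | zero => simp [hv0] at hK
  | succ K ih =>
    by_cases hu0 : h v - (K : ℂ) • v = 0
    · have h1 := key hv (sub_eq_zero.1 hu0) hv0
      exact ⟨h1 ▸ sub_eq_zero.1 hu0, K, by omega, h1⟩
    · obtain ⟨h1, h2⟩ := ih (hstab K hv) hu0 (by
        rwa [Finset.prod_range_succ, map_mul, Module.End.mul_apply, aeval_X_sub_C_apply] at hK)
      obtain ⟨i, hi, h2⟩ := h2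
      refine ⟨?_, i, by omega, h2⟩
      by_contra hne
      refine hu0 ?_
      have h3 : h (h v - μ • v) = (K : ℂ) • (h v - μ • v) := by
        simp only [map_sub, map_smul] at h1 ⊢
        rw [← sub_eq_zero] at h1 ⊢
        rw [← h1]; module
      have h4 := key (hstab μ hv) h3 (sub_ne_zero.2 hne)
      exact absurd (Nat.cast_injective (h2.symm.trans h4)) hi.ne

namespace Sl2Ops

variable {V : Type*} [AddCommGroup V] [Module ℂ V] {h e f : End ℂ V} (S : Sl2Ops h e f)
include S

lemma h_e_pow (n : ℕ) : h * e ^ n = e ^ n * h + (2 * n : ℂ) • e ^ n := by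
  induction n with
  | zero => simp
  | succ n ih =>
    have h2 : (2 : End ℂ V) * e = (2 : ℂ) • e := by
      ext; rw [Module.End.mul_apply, end_two_apply]; rfl
    rw [pow_succ, ← mul_assoc, ih, add_mul, mul_assoc, S.h_e, h2, mul_add, smul_mul_assoc,
      mul_smul_comm, ← mul_assoc, add_assoc, ← add_smul]
    congr 2; push_cast; ring

lemma exists_e_pow_eq_zero [FiniteDimensional ℂ V] : ∃ n, e ^ n = 0 := by
  by_contra! hne
  let D : End ℂ (End ℂ V) := LinearMap.mulLeft ℂ h - LinearMap.mulRight ℂ h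
  have hD (n : ℕ) : D.HasEigenvalue (2 * n : ℂ) :=
    Module.End.hasEigenvalue_of_hasEigenvector (x := e ^ n)
      ⟨Module.End.mem_eigenspace_iff.2 (by simp [D, S.h_e_pow n]), hne n⟩
  refine Set.infinite_of_injective_forall_mem (f := fun n : ℕ => (2 * n : ℂ)) ?_ hD
    (Module.End.finite_hasEigenvalue D)
  intro m n hmn
  simpa using hmn

lemma e_f_pow_succ_apply {v : V} (hv : e v = 0) (k : ℕ) :
    e ((f ^ (k + 1)) v) = (k + 1 : ℂ) • (f ^ k) (h v - (k : ℂ) • v) := by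
  have ef (w : V) : e (f w) = f (e w) + h w := LinearMap.congr_fun S.e_f w
  have hf (n : ℕ) (w : V) : h ((f ^ n) w) = (f ^ n) (h w) - (2 * n : ℂ) • (f ^ n) w := by
    have := LinearMap.congr_fun (S.symm.h_e_pow n) w
    simp only [neg_mul, LinearMap.neg_apply, Module.End.mul_apply, LinearMap.add_apply, mul_neg,
      LinearMap.smul_apply] at this
    rw [eq_sub_iff_add_eq, ← neg_inj, neg_add, this]; abel
  induction k with
  | zero => simp [ef, hv]
  | succ k ih =>
    rw [pow_succ', Module.End.mul_apply, ef, ih, hf]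
    simp only [map_sub, map_smul, pow_succ', Module.End.mul_apply]
    push_cast
    module

lemma e_pow_f_pow_apply {v : V} (hv : e v = 0) (k : ℕ) :
    (e ^ k) ((f ^ k) v) = (k.factorial : ℂ) •
      (Polynomial.aeval h (∏ i ∈ Finset.range k, (Polynomial.X - Polynomial.C (i : ℂ)))) v := by
  induction k generalizing v with
  | zero => simp
  | succ k ih =>
    have hv' : e (h v - (k : ℂ) • v) = 0 := by
      have := LinearMap.congr_fun S.h_e v
      rw [Module.End.mul_apply, LinearMap.add_apply, Module.End.mul_apply, Module.End.mul_apply, hv,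
        map_zero, map_zero, add_zero] at this
      rw [map_sub, map_smul, hv, ← this, smul_zero, sub_zero]
    rw [pow_succ, Module.End.mul_apply, S.e_f_pow_succ_apply hv, map_smul, ih hv',
      Finset.prod_range_succ, map_mul, Module.End.mul_apply, aeval_X_sub_C_apply,
      Nat.factorial_succ, smul_smul]
    push_cast
    rfl

lemma apply_eq_smul_of_e_eq_zero [FiniteDimensional ℂ V] {μ : ℂ} {v : V}
    (hv : v ∈ h.maxGenEigenspace μ) (hv0 : v ≠ 0) (hev : e v = 0) :
    h v = μ • v ∧ ∃ i : ℕ, μ = i := by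
  obtain ⟨K, hK⟩ := S.symm.exists_e_pow_eq_zero
  refine (apply_eq_smul_of_prod_apply_eq_zero K hv hv0 ?_).imp_right fun ⟨i, _, h⟩ => ⟨i, h⟩
  have h1 := S.e_pow_f_pow_apply hev K
  rw [hK, LinearMap.zero_apply, map_zero] at h1
  exact (smul_eq_zero.1 h1.symm).resolve_left (by exact_mod_cast K.factorial_ne_zero)

lemma mem_maxGenEigenspace_e_pow_apply {μ : ℂ} {v : V} (hv : v ∈ h.maxGenEigenspace μ) (k : ℕ) :
    (e ^ k) v ∈ h.maxGenEigenspace (μ + 2 * k) := by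
  rw [Module.End.mem_maxGenEigenspace] at hv ⊢
  obtain ⟨n, hn⟩ := hv
  refine ⟨n, ?_⟩
  have h1 : SemiconjBy (e ^ k) (h - μ • 1) (h - (μ + 2 * k) • 1) := by
    rw [SemiconjBy, mul_sub, sub_mul, S.h_e_pow, mul_smul_comm, smul_mul_assoc, mul_one, one_mul,
      add_smul]
    abel
  have h2 := LinearMap.congr_fun (h1.pow_right n) v
  rw [Module.End.mul_apply, Module.End.mul_apply, hn, map_zero] at h2
  exact h2.symm

lemma exists_top_of_mem_maxGenEigenspace [FiniteDimensional ℂ V] {c μ : ℂ} {v : V}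
    (hc : v ∈ (casimir h e f).maxGenEigenspace c) (hv : v ∈ h.maxGenEigenspace μ) (hv0 : v ≠ 0) :
    ∃ k m : ℕ, (e ^ k) v ≠ 0 ∧ h ((e ^ k) v) = (m : ℂ) • (e ^ k) v ∧ μ + 2 * k = m ∧
      c = (m ^ 2 + 2 * m : ℕ) := by
  obtain ⟨N, hN⟩ := S.exists_e_pow_eq_zero
  have hex : ∃ n, (e ^ n) v = 0 := ⟨N, by rw [hN, LinearMap.zero_apply]⟩
  classical
  obtain ⟨k, hk⟩ := Nat.exists_eq_succ_of_ne_zero (n := Nat.find hex) (by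
    intro h0
    have := Nat.find_spec hex
    rw [h0] at this
    exact hv0 (by simpa using this))
  have hk0 : (e ^ k) v ≠ 0 := Nat.find_min hex (hk ▸ Nat.lt_succ_self k)
  have hk1 : e ((e ^ k) v) = 0 := by
    have := Nat.find_spec hex
    rwa [hk, Nat.succ_eq_add_one, pow_succ', Module.End.mul_apply] at this
  obtain ⟨h1, m, h2⟩ :=
    S.apply_eq_smul_of_e_eq_zero (S.mem_maxGenEigenspace_e_pow_apply hv k) hk0 hk1
  rw [h2] at h1
  refine ⟨k, m, hk0, h1, h2, ?_⟩
  have h3 : (e ^ k) v ∈ (casimir h e f).maxGenEigenspace c :=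
    Module.End.mapsTo_maxGenEigenspace_of_comm (S.commute_e.pow_right k) c hc
  have h4 := casimir_apply_of_e_eq_zero (f := f) h1 hk1
  by_contra hne
  refine hk0 (Submodule.disjoint_def.1
    ((Module.End.independent_maxGenEigenspace (casimir h e f)).pairwiseDisjoint hne) _ h3 ?_)
  refine ((casimir h e f).genEigenspace _).monotone le_top (Module.End.mem_eigenspace_iff.2 ?_)
  rw [h4]
  push_cast
  rfl

/-- In a finite-dimensional representation of `sl₂`, the operator `h` is diagonalizable with
integral eigenvalues. -/
lemma iSup_eigenspace_h [FiniteDimensional ℂ V] : ⨆ n : ℤ, h.eigenspace (n : ℂ) = ⊤ := by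
  rw [eq_top_iff, ← Module.End.iSup_maxGenEigenspace_eq_top (casimir h e f), iSup_le_iff]
  intro c
  rw [Submodule.eq_iSup_inf_genEigenspace ⊤
    (Module.End.mapsTo_maxGenEigenspace_of_comm S.commute_h c)
    (Module.End.iSup_maxGenEigenspace_eq_top h), iSup_le_iff]
  rintro μ v ⟨hc, hv⟩
  by_cases hv0 : v = 0
  · rw [hv0]; exact zero_mem _
  have hdiag : h v - μ • v = 0 := by
    by_contra hw0
    obtain ⟨k, m, hk, hkm, hm, hcm⟩ := S.exists_top_of_mem_maxGenEigenspace hc hv hv0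
    obtain ⟨k', m', hk', -, hm', hcm'⟩ := S.exists_top_of_mem_maxGenEigenspace
      (sub_mem (Module.End.mapsTo_maxGenEigenspace_of_comm S.commute_h c hc)
        (Submodule.smul_mem _ μ hc))
      (sub_mem (Module.End.mapsTo_maxGenEigenspace_of_comm (Commute.refl h) μ hv)
        (Submodule.smul_mem _ μ hv)) hw0
    have hmm : m = m' := by
      have h1 : m ^ 2 + 2 * m = m' ^ 2 + 2 * m' := Nat.cast_injective (hcm.symm.trans hcm')
      nlinarith
    subst hmm
    have hkk : k = k' := by
      have := hm.trans hm'.symm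
      simpa using this
    subst hkk
    apply hk'
    have h1 := LinearMap.congr_fun (S.h_e_pow k) v
    simp only [Module.End.mul_apply, LinearMap.add_apply, LinearMap.smul_apply] at h1
    rw [map_sub, map_smul, eq_sub_of_add_eq h1.symm, hkm, ← hm]
    module
  obtain ⟨k, m, -, -, hm, -⟩ := S.exists_top_of_mem_maxGenEigenspace hc hv hv0
  refine Submodule.mem_iSup_of_mem ((m : ℤ) - 2 * k) (Module.End.mem_eigenspace_iff.2 ?_)
  rw [sub_eq_zero.1 hdiag, eq_sub_of_add_eq hm]
  push_cast
  rfl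

end Sl2Ops

end SerreE8

namespace SerreE8

open Module

namespace Sl2Ops

variable {V : Type*} [AddCommGroup V] [Module ℂ V] {h e f : End ℂ V} (S : Sl2Ops h e f)
  [FiniteDimensional ℂ V]
include S

lemma f_eq_zero_of_e_eq_zero {v : V} (hh : h v = 0) (he : e v = 0) : f v = 0 := by
  obtain ⟨K, hK⟩ := S.symm.exists_e_pow_eq_zero
  refine S.eq_zero_of_e_pow_eq_zero (fun v => ⟨K, by rw [hK]; rfl⟩) (n := 2) (k := 1) (by norm_num)
    ?_ ?_
  · rw [S.h_f_apply (μ := 0) (by rw [hh, zero_smul])]; congr 1; push_cast; ring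
  · have := LinearMap.congr_fun S.e_f v
    rw [Module.End.mul_apply] at this
    rw [pow_one, this, LinearMap.add_apply, Module.End.mul_apply, he, hh, map_zero, add_zero]

lemma eq_zero_of_e_f_eq_zero {v : V} (hv : h v = (2 : ℂ) • v) (h0 : e (f v) = 0) : v = 0 := by
  have hfv : h (f v) = 0 := by
    rw [S.h_f_apply hv, sub_self, zero_smul]
  obtain ⟨K, hK⟩ := S.exists_e_pow_eq_zero
  refine S.symm.eq_zero_of_e_pow_eq_zero (fun v => ⟨K, by rw [hK]; rfl⟩) (n := 2) (k := 2) le_rfl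
    ?_ ?_
  · rw [LinearMap.neg_apply, hv]; push_cast; module
  · rw [pow_two, Module.End.mul_apply, S.f_eq_zero_of_e_eq_zero hfv h0]

lemma exists_e_f_eq {U : Submodule ℂ V} (hUe : ∀ v ∈ U, e v ∈ U) (hUf : ∀ v ∈ U, f v ∈ U) {v : V}
    (hvU : v ∈ U) (hv : h v = (2 : ℂ) • v) :
    ∃ w ∈ U, h w = (2 : ℂ) • w ∧ e (f w) = v := by
  have hst : ∀ w ∈ U ⊓ h.eigenspace 2, (e * f) w ∈ U ⊓ h.eigenspace 2 := by
    rintro w ⟨hwU, hw⟩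
    refine ⟨hUe _ (hUf _ hwU), ?_⟩
    rw [SetLike.mem_coe, Module.End.mem_eigenspace_iff] at hw ⊢
    have h1 : Commute h (e * f) := by
      have h2 : h * (e * f) = e * (h * f) + 2 * e * f := by
        rw [← mul_assoc, S.h_e]; noncomm_ring
      rw [Commute, SemiconjBy, h2, S.h_f]; noncomm_ring
    rw [← Module.End.mul_apply, h1, Module.End.mul_apply, hw, map_smul]
  have hinj : Function.Injective ((e * f).restrict hst) := by
    rw [← LinearMap.ker_eq_bot, LinearMap.ker_eq_bot']
    rintro ⟨w, hw⟩ h0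
    exact Subtype.ext (S.eq_zero_of_e_f_eq_zero (Module.End.mem_eigenspace_iff.1 hw.2)
      (congrArg Subtype.val h0))
  obtain ⟨⟨w, hw⟩, h1⟩ := LinearMap.injective_iff_surjective.1 hinj
    ⟨v, hvU, Module.End.mem_eigenspace_iff.2 hv⟩
  exact ⟨w, hw.1, Module.End.mem_eigenspace_iff.1 hw.2, congrArg Subtype.val h1⟩

lemma finrank_eigenspace_zero {U : Submodule ℂ V} (hUe : ∀ v ∈ U, e v ∈ U)
    (hUf : ∀ v ∈ U, f v ∈ U) :
    finrank ℂ ↥(U ⊓ h.eigenspace 0) = finrank ℂ ↥(U ⊓ h.eigenspace 2) +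
      finrank ℂ ↥(U ⊓ h.eigenspace 0 ⊓ LinearMap.ker e) := by
  have hst : ∀ w ∈ U ⊓ h.eigenspace 0, e w ∈ U ⊓ h.eigenspace 2 := by
    rintro w ⟨hwU, hw⟩
    refine ⟨hUe _ hwU, ?_⟩
    rw [SetLike.mem_coe, Module.End.mem_eigenspace_iff] at hw ⊢
    rw [S.h_e_apply hw, zero_add]
  have hsurj : LinearMap.range (e.restrict hst) = ⊤ := by
    rw [LinearMap.range_eq_top]
    rintro ⟨v, hvU, hv⟩
    obtain ⟨w, hwU, hw, hwv⟩ := S.exists_e_f_eq hUe hUf hvU (Module.End.mem_eigenspace_iff.1 hv)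
    refine ⟨⟨f w, hUf w hwU, ?_⟩, Subtype.ext hwv⟩
    rw [SetLike.mem_coe, Module.End.mem_eigenspace_iff, S.h_f_apply hw, sub_self]
  have hker : finrank ℂ (LinearMap.ker (e.restrict hst)) =
      finrank ℂ ↥(U ⊓ h.eigenspace 0 ⊓ LinearMap.ker e) := by
    have h1 : (LinearMap.ker (e.restrict hst)).map (U ⊓ h.eigenspace 0).subtype =
        U ⊓ h.eigenspace 0 ⊓ LinearMap.ker e := by
      rw [LinearMap.ker_restrict, Submodule.map_comap_subtype]
    rw [← h1]
    exact (Submodule.equivMapOfInjective _ Subtype.val_injective _).finrank_eq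
  have := LinearMap.finrank_range_add_finrank_ker (e.restrict hst)
  rw [hsurj, finrank_top, hker] at this
  exact this.symm

end Sl2Ops

end SerreE8

namespace SerreE8

open Module LieAlgebra LieSubalgebra

variable {L : Type*} [LieRing L] [LieAlgebra ℂ L]

lemma mem_engel_iff_of_isSemisimple {s : L} (hs : (ad ℂ L s).IsSemisimple) {y : L} :
    y ∈ engel ℂ s ↔ ⁅s, y⁆ = 0 := by
  have : y ∈ engel ℂ s ↔ y ∈ (ad ℂ L s).maxGenEigenspace 0 := Iff.rfl
  rw [this, hs.isFinitelySemisimple.maxGenEigenspace_eq_eigenspace, Module.End.mem_eigenspace_iff,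
    zero_smul, ad_apply]

variable [FiniteDimensional ℂ L]

open Module.End in
/-- The abstract Jordan decomposition. -/
lemma exists_isSemisimple_ad [IsKilling ℂ L] (t : L) : ∃ s : L, IsNilpotent (ad ℂ L (t - s)) ∧
    (ad ℂ L s).IsSemisimple ∧ ∀ y : L, ⁅t, y⁆ = 0 → ⁅s, y⁆ = 0 := by
  obtain ⟨N, -, S, hS₀, hN, hS, hSN⟩ := (ad ℂ L t).exists_isNilpotent_isSemisimple
  replace hS₀ : Commute (ad ℂ L t) S := Algebra.commute_of_mem_adjoin_self hS₀
  have hNS : IsNilpotent (ad ℂ L t - S) := by rwa [hSN, add_sub_cancel_right]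
  have aux {μ : ℂ} {y : L} (hy : y ∈ (ad ℂ L t).maxGenEigenspace μ) : S y = μ • y :=
    apply_eq_of_mem_of_comm_of_isFinitelySemisimple_of_isNil hy hS₀ hS.isFinitelySemisimple hNS
  have hmem (y : L) : y ∈ ⨆ μ, (ad ℂ L t).maxGenEigenspace μ := by
    rw [iSup_maxGenEigenspace_eq_top]; trivial
  have h_der (y z : L) : S ⁅y, z⁆ = ⁅S y, z⁆ + ⁅y, S z⁆ := by
    induction hmem y using Submodule.iSup_induction' with
    | mem μ y hy =>
      induction hmem z using Submodule.iSup_induction' with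
      | mem ν z hz =>
        rw [aux hy, aux hz, aux (LieModule.lie_mem_maxGenEigenspace_toEnd hy hz), smul_lie,
          lie_smul, ← add_smul]
      | zero => simp
      | add _ _ _ _ h h' => simp only [lie_add, map_add, h, h']; abel
    | zero => simp
    | add _ _ _ _ h h' => simp only [add_lie, map_add, h, h']; abel
  have h_der' (y z : L) : S ⁅y, z⁆ = ⁅y, S z⁆ - ⁅z, S y⁆ := by
    rw [h_der, ← lie_skew z]; abel
  let D : LieDerivation ℂ L L := ⟨S, h_der'⟩
  obtain ⟨s, hs⟩ := LieDerivation.IsKilling.exists_eq_ad D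
  have hsS : ad ℂ L s = S := by rw [← LieDerivation.coe_ad_apply_eq_ad_apply, hs]
  refine ⟨s, by rwa [map_sub, hsS], hsS ▸ hS, fun y hy => ?_⟩
  have h0 : y ∈ (ad ℂ L t).maxGenEigenspace 0 :=
    ((ad ℂ L t).genEigenspace 0).monotone le_top
      (mem_eigenspace_iff.2 (by rw [zero_smul]; exact hy))
  rw [← ad_apply (R := ℂ), hsS, aux h0, zero_smul]

/-- Among pairwise commuting elements there is, up to taking linear combinations, one with
smallest Engel subalgebra. -/
lemma exists_engel_le (s : Set L) (hs : ∀ x ∈ s, ∀ y ∈ s, ⁅x, y⁆ = 0) :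
    ∃ x ∈ Submodule.span ℂ s, ∀ t ∈ s, engel ℂ x ≤ engel ℂ t := by
  have hab : ∀ x ∈ Submodule.span ℂ s, ∀ y ∈ Submodule.span ℂ s, ⁅x, y⁆ = 0 := by
    intro x hx y hy
    induction hx, hy using Submodule.span_induction₂ with
    | mem_mem x y hx hy => exact hs x hx y hy
    | zero_left => simp
    | zero_right => simp
    | add_left => simp [*]
    | add_right => simp [*]
    | smul_left => simp [*]
    | smul_right => simp [*]
  let A : LieSubalgebra ℂ L :=
    { Submodule.span ℂ s with
      lie_mem' := fun {x y} hx hy => by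
        rw [hab x hx y hy]; exact (Submodule.span ℂ s).zero_mem }
  have hcard : (finrank ℂ L : Cardinal) ≤ Cardinal.mk ℂ :=
    Cardinal.natCast_le_aleph0.trans (Cardinal.infinite_iff.mp inferInstance)
  obtain ⟨x, -, hmin⟩ := (measure fun x : A => finrank ℂ (engel ℂ (x : L))).wf.has_min Set.univ
    ⟨0, trivial⟩
  let Ex : {engel ℂ z | z ∈ A} := ⟨engel ℂ (x : L), x, x.2, rfl⟩
  refine ⟨x, x.2, fun t ht => ?_⟩
  suffices IsBot Ex from @this ⟨engel ℂ t, t, Submodule.subset_span ht, rfl⟩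
  refine engel_isBot_of_isMin hcard A Ex (fun y hy => ?_) ?_
  · rw [mem_engel_iff]
    exact ⟨1, by rw [pow_one, ad_apply, hab x x.2 y hy]⟩
  · rintro ⟨_, y, hy, rfl⟩ hyx
    suffices engel ℂ y = engel ℂ (x : L) from this.ge
    apply LieSubalgebra.toSubmodule_injective
    exact Submodule.eq_of_le_of_finrank_le hyx (not_lt.1 (hmin ⟨y, hy⟩ trivial))

end SerreE8

namespace SerreE8

open Module LieAlgebra LieSubalgebra

variable {L : Type*} [LieRing L] [LieAlgebra ℂ L]

lemma killingForm_ad_pow_apply (x t w : L) (n : ℕ) :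
    killingForm ℂ L ((ad ℂ L x ^ n) t) w = (-1) ^ n * killingForm ℂ L t ((ad ℂ L x ^ n) w) := by
  induction n generalizing w with
  | zero => simp
  | succ n ih =>
    rw [pow_succ', Module.End.mul_apply, ad_apply, LieModule.traceForm_apply_lie_apply', ih,
      show ⁅x, w⁆ = ad ℂ L x w from rfl, ← Module.End.mul_apply, ← pow_succ, ← pow_succ', pow_succ (-1 : ℂ)]
    ring

variable {c : LieSubalgebra ℂ L}

lemma coe_ad_pow_apply (x t : c) (n : ℕ) :
    (((ad ℂ c x ^ n) t : c) : L) = (ad ℂ L (x : L) ^ n) (t : L) := by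
  induction n with
  | zero => rfl
  | succ n ih => rw [pow_succ', pow_succ', Module.End.mul_apply, Module.End.mul_apply, ad_apply,
      ad_apply, ← ih]; rfl

lemma killingForm_eq_zero_of_isNilpotent {n t : L} (hn : IsNilpotent (ad ℂ L n))
    (hnt : ⁅n, t⁆ = 0) : killingForm ℂ L n t = 0 := by
  rw [killingForm_apply_apply]
  have hcomm : Commute (ad ℂ L n) (ad ℂ L t) := by
    ext y
    have := leibniz_lie n t y
    rw [hnt, zero_lie, zero_add] at this
    exact this
  have h1 := LinearMap.isNilpotent_trace_of_isNilpotent (hcomm.isNilpotent_mul_right hn)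
  exact isNilpotent_iff_eq_zero.1 h1

variable [FiniteDimensional ℂ L]

/-- An Engel subalgebra inherits nondegeneracy of the Killing form of the ambient algebra. -/
lemma eq_zero_of_forall_mem_engel
    (hc : ∀ x ∈ c, (∀ y ∈ c, killingForm ℂ L x y = 0) → x = 0) {x t : c} (ht : t ∈ engel ℂ x)
    (h0 : ∀ z ∈ engel ℂ x, killingForm ℂ L (t : L) (z : L) = 0) : t = 0 := by
  refine Subtype.ext (hc t t.2 fun y hy => ?_)
  obtain ⟨m, hm⟩ := (mem_engel_iff _ _ _).1 ht
  obtain ⟨n, hn, hmn⟩ := ((LinearMap.eventually_isCompl_ker_pow_range_pow (ad ℂ c x)).and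
    (Filter.eventually_ge_atTop m)).exists
  obtain ⟨z, hz, z', hz', hzz⟩ := Submodule.mem_sup.1
    (hn.sup_eq_top ▸ Submodule.mem_top : (⟨y, hy⟩ : c) ∈ _)
  obtain ⟨w, rfl⟩ := hz'
  have hy' : y = (z : L) + (((ad ℂ c x ^ n) w : c) : L) := congrArg Subtype.val hzz.symm
  have h1 : killingForm ℂ L (t : L) (((ad ℂ c x ^ n) w : c) : L) = 0 := by
    have h2 := killingForm_ad_pow_apply (x : L) (t : L) (w : L) n
    rw [← coe_ad_pow_apply, ← coe_ad_pow_apply] at h2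
    have h3 : (ad ℂ c x ^ n) t = 0 := by
      obtain ⟨k, rfl⟩ := Nat.exists_eq_add_of_le hmn
      rw [add_comm, pow_add, Module.End.mul_apply, hm, map_zero]
    rw [h3, ZeroMemClass.coe_zero, map_zero, LinearMap.zero_apply] at h2
    exact (mul_eq_zero.1 h2.symm).resolve_left (pow_ne_zero _ (by norm_num))
  rw [hy', map_add, h1, add_zero]
  exact h0 z ((mem_engel_iff _ _ _).2 ⟨n, hz⟩)

/-- A subalgebra on which the Killing form is nondegenerate and which is closed under Jordan parts
has a Cartan subalgebra which is the centralizer of a single semisimple element, and which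
consists of semisimple elements. -/
theorem exists_isSemisimple_of_nondegenerate [IsKilling ℂ L]
    (hc : ∀ x ∈ c, (∀ y ∈ c, killingForm ℂ L x y = 0) → x = 0)
    (hJ : ∀ t ∈ c, ∀ s : L, (∀ y : L, ⁅t, y⁆ = 0 → ⁅s, y⁆ = 0) → s ∈ c) :
    ∃ t₀ ∈ c, ∀ t ∈ c, ⁅t₀, t⁆ = 0 →
      (ad ℂ L t).IsSemisimple ∧ ∀ x : L, ⁅t₀, x⁆ = 0 → ⁅t, x⁆ = 0 := by
  obtain ⟨x₀, hx₀⟩ := exists_isCartanSubalgebra_engel ℂ c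
  have hker : LinearMap.ker (LieModule.traceForm ℂ (engel ℂ x₀) L) = ⊥ := by
    refine (LinearMap.ker_eq_bot').2 fun t ht => Subtype.ext ?_
    exact eq_zero_of_forall_mem_engel hc t.2 fun z hz => LinearMap.congr_fun ht ⟨z, hz⟩
  have habel := LieModule.isLieAbelian_of_ker_traceForm_eq_bot ℂ (engel ℂ x₀) L hker
  let T : Set L := {t | ∃ ht : t ∈ c, (⟨t, ht⟩ : c) ∈ engel ℂ x₀}
  have hab : ∀ t ∈ T, ∀ t' ∈ T, ⁅t, t'⁆ = 0 := by
    rintro t ⟨ht, hT⟩ t' ⟨ht', hT'⟩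
    have := habel.trivial ⟨_, hT⟩ ⟨_, hT'⟩
    exact congrArg (fun z => ((z : c) : L)) (congrArg Subtype.val this)
  have hself {s : L} (hs : s ∈ c) (h0 : ∀ t ∈ T, ⁅s, t⁆ = 0) : s ∈ T := by
    refine ⟨hs, ?_⟩
    rw [← normalizer_engel ℂ x₀, LieSubalgebra.mem_normalizer_iff]
    intro y hy
    have : ⁅(⟨s, hs⟩ : c), y⁆ = 0 := Subtype.ext (h0 y ⟨y.2, hy⟩)
    rw [this]
    exact zero_mem _
  have hss : ∀ t ∈ T, (ad ℂ L t).IsSemisimple := by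
    intro t ht
    obtain ⟨s, hn, hs, hst⟩ := exists_isSemisimple_ad t
    have hsT : s ∈ T := hself (hJ t ht.1 s hst) fun t' ht' => hst t' (hab t ht t' ht')
    have hnT : t - s ∈ T := by
      obtain ⟨ht, hT⟩ := ht
      obtain ⟨hs, hsT⟩ := hsT
      exact ⟨sub_mem ht hs, sub_mem hT hsT⟩
    have h0 := eq_zero_of_forall_mem_engel hc hnT.2 fun z hz =>
      killingForm_eq_zero_of_isNilpotent hn (hab _ hnT z ⟨z.2, hz⟩)
    rwa [sub_eq_zero.1 (congrArg Subtype.val h0)]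
  obtain ⟨t₀, ht₀, hle⟩ := exists_engel_le T hab
  have hspan : Submodule.span ℂ T ≤ (engel ℂ x₀).toSubmodule.map c.toSubmodule.subtype :=
    Submodule.span_le.2 fun t ⟨ht, hT⟩ => ⟨⟨t, ht⟩, hT, rfl⟩
  obtain ⟨t₁, ht₁, rfl⟩ := hspan ht₀
  have ht₁T : (t₁ : L) ∈ T := ⟨t₁.2, ht₁⟩
  refine ⟨t₁, t₁.2, fun t ht h0 => ?_⟩
  have hkey {x : L} (hx : ⁅(t₁ : L), x⁆ = 0) {t : L} (ht : t ∈ T) : ⁅t, x⁆ = 0 :=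
    (mem_engel_iff_of_isSemisimple (hss t ht)).1
      (hle t ht ((mem_engel_iff_of_isSemisimple (hss _ ht₁T)).2 hx))
  have htT : t ∈ T := hself ht fun t' ht' => by
    rw [← lie_skew, hkey h0 ht', neg_zero]
  exact ⟨hss t htT, fun x hx => hkey hx htT⟩

end SerreE8

namespace SerreE8

open Module LieAlgebra LieSubalgebra

variable {L : Type*} [LieRing L] [LieAlgebra ℂ L]

/-- The common centralizer of two elements. -/
def pairCentralizer (e f : L) : LieSubalgebra ℂ L where
  carrier := {x | ⁅e, x⁆ = 0 ∧ ⁅f, x⁆ = 0}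
  add_mem' := fun ⟨ha, ha'⟩ ⟨hb, hb'⟩ => by simp [*]
  zero_mem' := by simp
  smul_mem' := fun c _ ⟨ha, ha'⟩ => by simp [*]
  lie_mem' := fun ⟨ha, ha'⟩ ⟨hb, hb'⟩ => by
    simp only [Set.mem_ofPred_eq] at *
    constructor <;> rw [leibniz_lie] <;> simp [*]

variable [FiniteDimensional ℂ L] {h e f : L} (hhe : ⁅h, e⁆ = (2 : ℂ) • e)
  (hhf : ⁅h, f⁆ = (-2 : ℂ) • f) (hef : ⁅e, f⁆ = h)
include hhe hhf hef

lemma eq_zero_of_mem_pairCentralizer [IsKilling ℂ L] {x : L} (hx : x ∈ pairCentralizer e f)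
    (h0 : ∀ y ∈ pairCentralizer e f, killingForm ℂ L x y = 0) : x = 0 := by
  have S := sl2Ops_ad hhe hhf hef
  obtain ⟨hxe, hxf⟩ := hx
  have he (z : L) : killingForm ℂ L x ⁅e, z⁆ = 0 := by
    rw [← LieModule.traceForm_apply_lie_apply, ← lie_skew, hxe]; simp
  have hf (z : L) : killingForm ℂ L x ⁅f, z⁆ = 0 := by
    rw [← LieModule.traceForm_apply_lie_apply, ← lie_skew, hxf]; simp
  refine LinearMap.ker_eq_bot'.1 (IsKilling.ker_killingForm_eq_bot ℂ L) x (LinearMap.ext fun y => ?_)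
  have hy : y ∈ ⨆ n : ℤ, (ad ℂ L h).eigenspace (n : ℂ) := S.iSup_eigenspace_h ▸ Submodule.mem_top
  induction hy using Submodule.iSup_induction' with
  | zero => simp
  | add _ _ _ _ h1 h2 => simp [h1, h2]
  | mem n y hy =>
    rw [Module.End.mem_eigenspace_iff, ad_apply] at hy
    by_cases hn : n = 0
    · subst hn
      rw [Int.cast_zero, zero_smul] at hy
      obtain ⟨w, -, hw, hwy⟩ := S.exists_e_f_eq (U := ⊤) (fun _ _ => trivial) (fun _ _ => trivial)
        (v := ⁅e, y⁆) trivial (by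
          have := S.h_e_apply (μ := 0) (v := y) (by simpa using hy)
          simpa using this)
      have hwe : ad ℂ L e (y - ⁅f, w⁆) = 0 := by
        rw [map_sub, ad_apply, show ⁅f, w⁆ = ad ℂ L f w from rfl, hwy, sub_self]
      have hwh : ad ℂ L h (y - ⁅f, w⁆) = 0 := by
        have := S.h_f_apply hw
        rw [sub_self, zero_smul] at this
        rw [map_sub, ad_apply, hy, show ⁅f, w⁆ = ad ℂ L f w from rfl, this, sub_zero]
      have hmem : y - ⁅f, w⁆ ∈ pairCentralizer e f := ⟨hwe, S.f_eq_zero_of_e_eq_zero hwh hwe⟩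
      rw [← sub_add_cancel y ⁅f, w⁆, map_add, h0 _ hmem, hf, add_zero, LinearMap.zero_apply]
    · have h1 : killingForm ℂ L x ((n : ℂ) • y) = 0 := by
        rw [← hy, ← hef, lie_lie, map_sub, he, hf, sub_zero]
      rw [map_smul] at h1
      exact (smul_eq_zero.1 h1).resolve_left (by exact_mod_cast hn)

/-- The centralizer of an `sl₂`-triple contains an element `t` whose centralizer within it is a
toral subalgebra, central in the centralizer of `t`. -/
lemma exists_mem_pairCentralizer [IsKilling ℂ L] : ∃ t₀ ∈ pairCentralizer e f,
    ∀ t ∈ pairCentralizer e f, ⁅t₀, t⁆ = 0 →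
      (ad ℂ L t).IsSemisimple ∧ ∀ x : L, ⁅t₀, x⁆ = 0 → ⁅t, x⁆ = 0 := by
  refine exists_isSemisimple_of_nondegenerate
    (fun x hx h0 => eq_zero_of_mem_pairCentralizer hhe hhf hef hx h0) fun t ht s hs => ?_
  obtain ⟨h1, h2⟩ := ht
  constructor <;> rw [← lie_skew, hs _ (by rw [← lie_skew, ‹⁅_, t⁆ = 0›, neg_zero]), neg_zero]

end SerreE8

namespace SerreE8

open NormedSpace Filter Topology

section Exp

variable {V : Type*} [NormedAddCommGroup V] [NormedSpace ℂ V] [CompleteSpace V]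

lemma exp_neg_apply_exp_apply (D : V →L[ℂ] V) (v : V) : exp (-D) (exp D v) = v := by
  have h : exp (-D) * exp D = 1 := by
    let : NormedAlgebra ℚ (V →L[ℂ] V) := .restrictScalars ℚ ℂ _
    rw [← exp_add_of_commute (Commute.refl D).neg_left, neg_add_cancel, exp_zero]
  exact congrArg (fun T : V →L[ℂ] V => T v) h

lemma exp_apply_exp_neg_apply (D : V →L[ℂ] V) (v : V) : exp D (exp (-D) v) = v := by
  simpa using exp_neg_apply_exp_apply (-D) v

/-- The exponential of a derivation of a bilinear map is an automorphism. -/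
lemma exp_apply_bilin (B : V →L[ℂ] V →L[ℂ] V) (D : V →L[ℂ] V)
    (hD : ∀ a b, D (B a b) = B (D a) b + B a (D b)) (a b : V) :
    exp D (B a b) = B (exp D a) (exp D b) := by
  have hexp : ∀ (D : V →L[ℂ] V) (v : V) (t : ℂ),
      HasDerivAt (fun t : ℂ => exp (t • D) v) (D (exp (t • D) v)) t := by
    intro D v t
    simpa using (hasDerivAt_exp_smul_const' D t).clm_apply (hasDerivAt_const t v)
  let g : ℂ → V := fun t => exp (t • -D) (B (exp (t • D) a) (exp (t • D) b))
  have hg : ∀ t, HasDerivAt g 0 t := by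
    intro t
    have h1 := B.hasDerivAt_of_bilinear (fun _ => hexp D a t) (fun _ => hexp D b t)
    have h2 := (hasDerivAt_exp_smul_const (-D) t).clm_apply h1
    convert h2 using 1
    simp only [mul_apply_eq_comp, neg_apply, hD, map_neg, map_add]
    abel
  have h0 : g 1 = g 0 :=
    is_const_of_deriv_eq_zero (fun t => (hg t).differentiableAt) (fun t => (hg t).deriv) 1 0
  simp only [g, one_smul, zero_smul, exp_zero, one_apply_eq_self] at h0
  rw [← h0, exp_apply_exp_neg_apply]

end Exp

lemma eventually_exists_exp {V : Type*} [NormedAddCommGroup V] [NormedSpace ℂ V]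
    [FiniteDimensional ℂ V] (A : V →L[ℂ] V →L[ℂ] V) (x : V) (K : Submodule ℂ V)
    (h : ∀ w, ∃ k ∈ K, ∃ z, k + A z x = w) :
    ∀ᶠ v in 𝓝 x, ∃ k ∈ K, ∃ z, exp (A z) (x + k) = v := by
  have := FiniteDimensional.complete ℂ V
  have h1 : HasStrictFDerivAt (exp : (V →L[ℂ] V) → V →L[ℂ] V) (1 : (V →L[ℂ] V) →L[ℂ] V →L[ℂ] V)
      (A 0) := by
    rw [map_zero]; exact hasStrictFDerivAt_exp_zero
  let F : K × V → V := fun p => exp (A p.2) (x + p.1)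
  have h2 : HasStrictFDerivAt (fun p : K × V => exp (A p.2)) _ ((0, 0) : K × V) :=
    HasStrictFDerivAt.comp ((0, 0) : K × V) (f := fun p : K × V => A p.2) h1
      (A.hasStrictFDerivAt.comp _ hasStrictFDerivAt_snd)
  have h3 : HasStrictFDerivAt (fun p : K × V => x + (p.1 : V)) _ ((0, 0) : K × V) :=
    (K.subtypeL.hasStrictFDerivAt.comp _ hasStrictFDerivAt_fst).const_add x
  have h4 := h2.clm_apply h3
  have h5 := h4.map_nhds_eq_of_surj (by
    rw [LinearMap.range_eq_top]
    intro w
    obtain ⟨k, hk, z, rfl⟩ := h w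
    refine ⟨(⟨k, hk⟩, z), ?_⟩
    simp)
  have h7 : exp (A (0, (0 : V)).2) (x + ((0 : K × V).1 : V)) = x := by simp
  have h6 : ∀ᶠ v in map F (𝓝 (0, 0)), ∃ k ∈ K, ∃ z, exp (A z) (x + k) = v := by
    rw [eventually_map]
    exact .of_forall fun p => ⟨p.1, p.1.2, p.2, rfl⟩
  rwa [show map F (𝓝 (0, 0)) = 𝓝 x from h5.trans (congrArg 𝓝 h7)] at h6

end SerreE8

namespace SerreE8

open NormedSpace Filter Topology LieAlgebra LieSubalgebra Module

section Engel

variable {L : Type*} [LieRing L] [LieAlgebra ℂ L]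

lemma apply_mem_engel_apply (θ : L ≃ₗ⁅ℂ⁆ L) (x z : L) :
    θ z ∈ engel ℂ (θ x) ↔ z ∈ engel ℂ x := by
  have h (n : ℕ) : (ad ℂ L (θ x) ^ n) (θ z) = θ ((ad ℂ L x ^ n) z) := by
    induction n with
    | zero => simp
    | succ n ih => 
      simp only [pow_succ', Module.End.mul_apply, ih, ad_apply]
      exact (LieHom.map_lie θ.toLieHom _ _).symm
  simp [mem_engel_iff, h]

/-- Two elements whose Engel subalgebras are conjugate under an automorphism. -/
def EngelConj (x y : L) : Prop := ∃ θ : L ≃ₗ⁅ℂ⁆ L, ∀ z, z ∈ engel ℂ x ↔ θ z ∈ engel ℂ y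

lemma EngelConj.symm {x y : L} (h : EngelConj x y) : EngelConj y x := by
  obtain ⟨θ, hθ⟩ := h
  exact ⟨θ.symm, fun z => by simp [hθ]⟩

lemma EngelConj.trans {x y z : L} (h : EngelConj x y) (h' : EngelConj y z) : EngelConj x z := by
  obtain ⟨θ, hθ⟩ := h
  obtain ⟨θ', hθ'⟩ := h'
  exact ⟨θ.trans θ', fun z => by simp [hθ, hθ']⟩

end Engel

section Conj

variable {L : Type*} [LieRing L] [LieAlgebra ℂ L] [FiniteDimensional ℂ L]

lemma exists_mem_engel_add_lie (x w : L) : ∃ k ∈ engel ℂ x, ∃ z : L, k + ⁅z, x⁆ = w := by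
  have h := (LinearMap.isCompl_iSup_ker_pow_iInf_range_pow (ad ℂ L x)).codisjoint.eq_top
  obtain ⟨k, hk, r, hr, rfl⟩ := Submodule.mem_sup.1 (h ▸ Submodule.mem_top : w ∈ _)
  have hr1 := (Submodule.mem_iInf _).1 hr 1
  rw [pow_one] at hr1
  obtain ⟨z, rfl⟩ := hr1
  refine ⟨k, ?_, -z, by simp⟩
  rw [mem_engel_iff]
  rw [Submodule.mem_iSup_of_directed] at hk
  · exact hk
  · exact (monotone_nat_of_le_succ fun n => by
      intro y hy
      rw [LinearMap.mem_ker] at hy ⊢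
      rw [pow_succ', Module.End.mul_apply, hy, map_zero]).directed_le

lemma eventually_exists_lieEquiv (x : L) :
    ∀ᶠ v in 𝓝 ((finBasis ℂ L).equivFun x), ∃ θ : L ≃ₗ⁅ℂ⁆ L, ∃ k ∈ engel ℂ x,
      (finBasis ℂ L).equivFun (θ k) = v := by
  set ψ := (finBasis ℂ L).equivFun
  let V := Fin (finrank ℂ L) → ℂ
  let B : V →L[ℂ] V →L[ℂ] V := LinearMap.toContinuousLinearMap
    (LinearMap.toContinuousLinearMap.toLinearMap ∘ₗ
      LinearMap.mk₂ ℂ (fun a b => ψ ⁅ψ.symm a, ψ.symm b⁆)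
        (by simp) (by simp) (by simp) (by simp))
  have hB (a b : V) : B a b = ψ ⁅ψ.symm a, ψ.symm b⁆ := rfl
  have hD (z a b : V) : B z (B a b) = B (B z a) b + B a (B z b) := by
    simp only [hB, LinearEquiv.symm_apply_apply]
    rw [leibniz_lie, map_add]
  let θ (z : V) : L ≃ₗ⁅ℂ⁆ L :=
    { toFun := fun y => ψ.symm (exp (B z) (ψ y))
      invFun := fun y => ψ.symm (exp (-B z) (ψ y))
      left_inv := fun y => by simp [exp_neg_apply_exp_apply]
      right_inv := fun y => by simp [exp_apply_exp_neg_apply]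
      map_add' := by simp
      map_smul' := by simp
      map_lie' := fun {y y'} => by
        have := exp_apply_bilin B (B z) (hD z) (ψ y) (ψ y')
        simp only [hB, LinearEquiv.symm_apply_apply] at this
        simp [this] }
  have h := eventually_exists_exp B (ψ x) ((engel ℂ x).toSubmodule.map ψ.toLinearMap) fun w => by
    obtain ⟨k, hk, z, hz⟩ := exists_mem_engel_add_lie x (ψ.symm w)
    refine ⟨ψ k, ⟨k, hk, rfl⟩, ψ z, ?_⟩
    rw [hB, ψ.symm_apply_apply, ψ.symm_apply_apply, ← map_add, hz, ψ.apply_symm_apply]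
  filter_upwards [h]
  rintro v ⟨_, ⟨k, hk, rfl⟩, z, rfl⟩
  refine ⟨θ z, x + k, add_mem (self_mem_engel ℂ x) hk, ?_⟩
  change ψ (ψ.symm (exp (B z) (ψ (x + k)))) = _
  simp

lemma finite_setOf_not_isRegular {x y : L} {s₀ : ℂ} (h : IsRegular ℂ (x + s₀ • y)) :
    {s : ℂ | ¬ IsRegular ℂ (x + s • y)}.Finite := by
  classical
  let b := finBasis ℂ L
  obtain ⟨P, hP⟩ : ∃ P, ∀ z : L, IsRegular ℂ z ↔ MvPolynomial.eval (b.repr z) P ≠ 0 :=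
    ⟨_, fun z => isRegular_iff_coeff_polyCharpoly_rank_ne_zero ℂ b z⟩
  let Q : Polynomial ℂ := MvPolynomial.aeval
    (fun i => Polynomial.C (b.repr x i) + Polynomial.X * Polynomial.C (b.repr y i)) P
  have hQ (s : ℂ) : Q.eval s = MvPolynomial.eval (b.repr (x + s • y)) P := by
    rw [← Polynomial.coe_evalRingHom]
    dsimp only [Q]
    rw [MvPolynomial.aeval_def, MvPolynomial.hom_eval₂,
      MvPolynomial.eval, MvPolynomial.coe_eval₂Hom]
    congr 1
    · ext; simp
    · ext; simp; exact mul_comm _ _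
  have hQ0 : Q ≠ 0 := by
    rintro h0
    refine (hP _).1 h ?_
    rw [← hQ, h0, Polynomial.eval_zero]
  refine (Polynomial.finite_setOfPred_isRoot hQ0).subset fun s hs => ?_
  rw [Set.mem_ofPred_eq, hP, ← hQ, not_not] at hs
  exact hs

lemma engel_le_of_isRegular {x u : L} (hx : IsRegular ℂ x) (hu : u ∈ engel ℂ x) :
    engel ℂ x ≤ engel ℂ u := by
  have hcard : (finrank ℂ L : Cardinal) ≤ Cardinal.mk ℂ :=
    Cardinal.natCast_le_aleph0.trans (Cardinal.infinite_iff.mp inferInstance)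
  let Ex : {engel ℂ z | z ∈ engel ℂ x} := ⟨engel ℂ x, x, self_mem_engel _ _, rfl⟩
  suffices IsBot Ex from @this ⟨engel ℂ u, u, hu, rfl⟩
  apply engel_isBot_of_isMin hcard (engel ℂ x) Ex le_rfl
  rintro ⟨_, y, hy, rfl⟩ hyx
  suffices finrank ℂ (engel ℂ x) ≤ finrank ℂ (engel ℂ y) by
    suffices engel ℂ y = engel ℂ x from this.ge
    apply LieSubalgebra.toSubmodule_injective
    exact Submodule.eq_of_le_of_finrank_le hyx this
  rw [(isRegular_iff_finrank_engel_eq_rank ℂ x).mp hx]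
  apply rank_le_finrank_engel

lemma isRegular_apply_iff (θ : L ≃ₗ⁅ℂ⁆ L) (x : L) : IsRegular ℂ (θ x) ↔ IsRegular ℂ x := by
  rw [isRegular_iff_finrank_engel_eq_rank, isRegular_iff_finrank_engel_eq_rank]
  have h : (engel ℂ (θ x)).toSubmodule =
      (engel ℂ x).toSubmodule.map (θ.toLinearEquiv : L →ₗ[ℂ] L) := by
    ext z
    rw [Submodule.mem_map_equiv]
    have := apply_mem_engel_apply θ x (θ.symm z)
    rwa [LieEquiv.apply_symm_apply] at this
  have := LinearEquiv.finrank_map_eq θ.toLinearEquiv (engel ℂ x).toSubmodule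
  rw [← h] at this
  exact this ▸ Iff.rfl

lemma eventually_engelConj {x : L} (hx : IsRegular ℂ x) :
    ∀ᶠ v in 𝓝 ((finBasis ℂ L).equivFun x), IsRegular ℂ ((finBasis ℂ L).equivFun.symm v) →
      EngelConj x ((finBasis ℂ L).equivFun.symm v) := by
  filter_upwards [eventually_exists_lieEquiv x]
  rintro _ ⟨θ, k, hk, rfl⟩ h
  rw [LinearEquiv.symm_apply_apply] at h ⊢
  rw [isRegular_apply_iff] at h
  have hkx : (engel ℂ x).toSubmodule = (engel ℂ k).toSubmodule :=
    Submodule.eq_of_le_of_finrank_eq (engel_le_of_isRegular hx hk)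
      (((isRegular_iff_finrank_engel_eq_rank ℂ x).1 hx).trans
        ((isRegular_iff_finrank_engel_eq_rank ℂ k).1 h).symm)
  refine ⟨θ, fun z => ?_⟩
  rw [apply_mem_engel_apply, LieSubalgebra.toSubmodule_injective hkx]

/-- The Engel subalgebras of any two regular elements are conjugate. -/
lemma engelConj_of_isRegular {x y : L} (hx : IsRegular ℂ x) (hy : IsRegular ℂ y) :
    EngelConj x y := by
  let p (s : ℂ) : L := x + s • (y - x)
  have hp0 : p 0 = x := by simp [p]
  have hp1 : p 1 = y := by simp [p]
  let S : Set ℂ := {s | ¬ IsRegular ℂ (p s)}ᶜ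
  have hS : IsPreconnected S :=
    ((finite_setOf_not_isRegular (s₀ := 0) (by simpa using hx)).countable
      |>.isConnected_compl_of_one_lt_rank (by
        rw [Complex.rank_real_complex]; exact Cardinal.one_lt_two)).isPreconnected
  have : PreconnectedSpace S := Subtype.preconnectedSpace hS
  have hcont : Continuous fun s : S => (finBasis ℂ L).equivFun (p s) := by
    simp only [p, map_add, map_smul]
    fun_prop
  have hloc : IsLocallyConstant fun s : S => EngelConj x (p s) := by
    rw [IsLocallyConstant.iff_eventually_eq]
    intro s
    have hs : IsRegular ℂ (p s) := not_not.1 s.2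
    filter_upwards [hcont.continuousAt.eventually (eventually_engelConj hs)] with s' hs'
    rw [LinearEquiv.symm_apply_apply] at hs'
    have h := hs' (not_not.1 s'.2)
    exact propext ⟨fun h' => h'.trans h.symm, fun h' => h'.trans h⟩
  have h0 : (0 : ℂ) ∈ S := fun h => h (hp0 ▸ hx)
  have h1 : (1 : ℂ) ∈ S := fun h => h (hp1 ▸ hy)
  have := hloc.apply_eq_of_preconnectedSpace ⟨0, h0⟩ ⟨1, h1⟩
  rw [hp0, hp1] at this
  exact this ▸ ⟨.refl, fun z => Iff.rfl⟩

lemma exists_isRegular_mem_engel (x : L) : ∃ y ∈ engel ℂ x, IsRegular ℂ y := by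
  obtain ⟨r, hr⟩ := LieAlgebra.exists_isRegular ℂ L
  let p (s : ℂ) : L := x + s • (r - x)
  have hfin : {s | ¬ IsRegular ℂ (p s)}.Finite :=
    finite_setOf_not_isRegular (s₀ := 1) (by simpa using hr)
  have hcont : Continuous fun s : ℂ => (finBasis ℂ L).equivFun (p s) := by
    simp only [p, map_add, map_smul]
    fun_prop
  have h := eventually_exists_lieEquiv x
  rw [show x = p 0 by simp [p]] at h
  have h' := hcont.continuousAt.eventually h
  obtain ⟨s, hs, hs'⟩ := (hfin.countable.dense_compl ℂ).exists_mem_open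
    isOpen_interior ⟨0, mem_interior_iff_mem_nhds.2 h'⟩
  obtain ⟨θ, k, hk, hθ⟩ := interior_subset hs'
  rw [show p 0 = x by simp [p]] at hk
  refine ⟨k, hk, ?_⟩
  rw [← isRegular_apply_iff θ, (finBasis ℂ L).equivFun.injective hθ]
  exact not_not.1 hs

end Conj

end SerreE8

namespace SerreE8

open LieAlgebra LieSubalgebra

namespace IsSerreSystem

variable {L : Type*} [LieRing L] [LieAlgebra ℂ L] {H E F : Fin 8 → L} (hS : IsSerreSystem H E F)
include hS

lemma map (θ : L ≃ₗ⁅ℂ⁆ L) : IsSerreSystem (θ ∘ H) (θ ∘ E) (θ ∘ F) := by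
  have hlie (x y : L) : ⁅θ x, θ y⁆ = θ ⁅x, y⁆ := (LieHom.map_lie θ.toLieHom x y).symm
  have hpow (n : ℕ) (x y : L) : (ad ℂ L (θ x) ^ n) (θ y) = θ ((ad ℂ L x ^ n) y) := by
    induction n with
    | zero => simp
    | succ n ih => simp [pow_succ', ih, hlie]
  have h0 : θ 0 = 0 := map_zero θ.toLieHom
  have hsmul (c : ℂ) (x : L) : θ (c • x) = c • θ x := map_smul θ.toLieHom c x
  refine ⟨fun i j => ?_, fun i => ?_, fun i j hij => ?_, fun i j => ?_, fun i j => ?_,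
    fun i j => ?_, fun i j => ?_, fun S hE hF => ?_⟩
  · simp [hlie, hS.lie_h_h, h0]
  · simp [hlie, hS.lie_e_f_same]
  · simp [hlie, hS.lie_e_f_ne i j hij, h0]
  · simp only [Function.comp_apply, hlie, hS.lie_h_e, hsmul]
  · simp only [Function.comp_apply, hlie, hS.lie_h_f, hsmul]
  · simp only [Function.comp_apply, hlie, hpow, hS.ad_e, h0]
  · simp only [Function.comp_apply, hlie, hpow, hS.ad_f, h0]
  · have := hS.eq_top (S.comap θ.toLieHom) hE hF
    rw [eq_top_iff]
    intro x _
    have hx : θ.symm x ∈ S.comap θ.toLieHom := this ▸ LieSubalgebra.mem_top _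
    have : θ (θ.symm x) ∈ S := hx
    rwa [LieEquiv.apply_symm_apply] at this

lemma wtSpace_zero_eq_engel : wtSpace H 0 = (engel ℂ (sepElt H)).toSubmodule := by
  rw [wtSpace, map_zero, eigenspace_eq_maxGenEigenspace hS.iSup_eigenspace]
  rfl

/-- Elements commuting with all of an Engel subalgebra lie in a common split Cartan
subalgebra. -/
lemma exists_forall_mem_span (x : L) : ∃ H' E' F' : Fin 8 → L, IsSerreSystem H' E' F' ∧
    ∀ a, (∀ z ∈ engel ℂ x, ⁅a, z⁆ = 0) → a ∈ Submodule.span ℂ (Set.range H') := by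
  have := hS.finiteDimensional
  obtain ⟨y, hy, hyreg⟩ := exists_isRegular_mem_engel (sepElt H)
  obtain ⟨z, hz, hzreg⟩ := exists_isRegular_mem_engel x
  obtain ⟨θ, hθ⟩ := engelConj_of_isRegular hyreg hzreg
  refine ⟨_, _, _, hS.map θ, fun a ha => ?_⟩
  have hy' : y ∈ wtSpace H 0 := hS.wtSpace_zero_eq_engel ▸ hy
  have hsep : sepElt H ∈ engel ℂ y := by
    rw [mem_engel_iff]
    refine ⟨1, ?_⟩
    rw [wtSpace, map_zero, Module.End.mem_eigenspace_iff, ad_apply, zero_smul] at hy'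
    rw [pow_one, ad_apply, ← lie_skew, hy', neg_zero]
  have haz : a ∈ engel ℂ z := by
    rw [mem_engel_iff]
    refine ⟨1, ?_⟩
    rw [pow_one, ad_apply, ← lie_skew, ha z hz, neg_zero]
  have h1 : θ.symm a ∈ engel ℂ y := by rwa [hθ, LieEquiv.apply_symm_apply]
  have h2 : θ.symm a ∈ wtSpace H 0 := by
    rw [hS.wtSpace_zero_eq_engel]
    exact engel_le_of_isRegular hyreg hsep h1
  rw [hS.wtSpace_zero] at h2
  have h3 := Submodule.mem_map_of_mem (f := (θ.toLinearEquiv : L →ₗ[ℂ] L)) h2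
  rw [Submodule.map_span, ← Set.range_comp] at h3
  have h4 : θ (θ.symm a) ∈ Submodule.span ℂ (Set.range (θ ∘ H)) := h3
  rwa [LieEquiv.apply_symm_apply] at h4

end IsSerreSystem

end SerreE8

namespace SerreE8

/-- The number whose 120 digits in base 256 are all equal to 1. -/
def packedOnes : ℕ :=
  38216917691764702275895617207353679650495007284686304026932966498874308591240886676335745356400040232256097710711406541895918313196874878614031322730637856547181481176299894234787410413686484895501174876389091681857590580099587744885279857315564571030697014914134421753262072901929074945

/-- The number of digits at least `m` among the 120 digits in base 256 of `S`, provided that these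
are less than 128. -/
def countGE (m S : ℕ) : ℕ := ((S + (128 - m) * packedOnes) &&& (128 * packedOnes)) / 128 % 255

/-- The coordinates of the positive roots, in base 256. -/
def packedRoots : List ℕ :=
  [76433835383529404549727552413170313372314547350780957420226277662650345112801374656712834790676974074038883338894895313245393687079933860653979544262842663397881138085317688681515477230320898853575150636606110508587822594425378316544857816938175989464574442963303832196775442272974012417,
 114650753075293971584278788144651115135368460373710270146096137383096824463755647792927147607100984847438365167325192109892479210308428498896480688769525801321812753225126549529684751034638467335372688436963824145997174724129241328263714048209371766742664579447802701493190633643017502976,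
 152867670767058808573216194434393914932384953960691003262340444875602786243815733683577895371764010874274839955617261761405571111914966343694790064872005237170150957248074189954609900227111147425291622626182125341932819061803893830655791236696552209847646761714612294502713850777007357952,
 229301506150553455571214951037727747386108054161252168145643907084411396995850992180314879863574407094162752228642535696936666103742756915385610902720334277632597745808959871387723614706537264138413795534291099923981625328834378163127957098595304408497050572739263664970116707323268300800,
 191084588449925441834837552812111295190414218313593871497109975026265659594507173233577227062096753645372043282917907227780591812153947990307603958456566869516377193003102555731803624299573377446724574062915106713132207653843923237578671221346681496979126271176178581306427635262711398400,
 152867668489153005675605963317676823151652837878110268667342625105673081280689026126248240911569593411777220033992672159140074252667315066856386858276275833996128779584377338359528271609525197916607848091118187908471225450145203901000058857817989869031265673729081546400967950701206437888,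
 114650169931408429265701440617159803696363401745351030819722265693907480740199976524720686104586498330110060852854215026255617808564931787165513031147715057473060714594200999077452409186851196429696191907401497381056571134253489987925169098923905585412889704380505965062663757888009273344,
 76284550548795948683526017159991133989855268447166802177208208004700206692599445136575696211079498953204112719986552631133385220438640696987262411278451657076486345304795101314735295327469522681945351622729479263358575433472568926969406369591762140003132780106836936383944052184530812928]

/-- Given the values `S` of a partial labelling of the Dynkin diagram on the positive roots (in
base 256), checks an inequality for all ways to complete the labelling. -/
def labelCheck : List ℕ → ℕ → ℕ → ℕ → Bool
  | [], S, k, o => (countGE 2 S + o + 2 * countGE 1 S).ble (countGE 3 S + 240 + k)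
  | c :: l, S, k, o => labelCheck l S (k + 1) o && labelCheck l (S + c) (k + 1) 1 &&
      labelCheck l (S + 2 * c) (k + 1) o && labelCheck l (S + 3 * c) k o

lemma labelCheck_eq : labelCheck packedRoots 0 0 0 = true := by decide +kernel

lemma land_add_mul (a b x y : ℕ) (ha : a < 256) (hb : b < 256) :
    (a + 256 * x) &&& (b + 256 * y) = (a &&& b) + 256 * (x &&& y) := by
  have h := Nat.and_lt_two_pow (n := 8) a hb
  have h1 := Nat.and_mod_two_pow (a := a + 256 * x) (b := b + 256 * y) (n := 8)
  have h2 := Nat.and_div_two_pow (a := a + 256 * x) (b := b + 256 * y) (n := 8)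
  have h3 : (a + 256 * x) % 2 ^ 8 = a := by omega
  have h4 : (b + 256 * y) % 2 ^ 8 = b := by omega
  have h5 : (a + 256 * x) / 2 ^ 8 = x := by omega
  have h6 : (b + 256 * y) / 2 ^ 8 = y := by omega
  rw [h3, h4] at h1
  rw [h5, h6] at h2
  omega

lemma land_ofDigits {m : ℕ} (hm : 1 ≤ m) (hm' : m ≤ 128) (l : List ℕ) (hl : ∀ d ∈ l, d < 128) :
    (Nat.ofDigits 256 l + (128 - m) * Nat.ofDigits 256 (List.replicate l.length 1)) &&&
      (128 * Nat.ofDigits 256 (List.replicate l.length 1)) =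
    128 * Nat.ofDigits 256 (l.map fun d => if m ≤ d then 1 else 0) := by
  induction l with
  | nil => simp
  | cons d l ih =>
    have hd := hl d (by simp)
    have ih := ih fun d hd => hl d (by simp [hd])
    simp only [List.map_cons, Nat.ofDigits_cons, List.length_cons, List.replicate_succ]
    set x := Nat.ofDigits 256 l
    set y := Nat.ofDigits 256 (List.replicate l.length 1)
    have h1 : d + 256 * x + (128 - m) * (1 + 256 * y) = (d + (128 - m)) + 256 * (x + (128 - m) * y) := by
      ring
    have h2 : 128 * (1 + 256 * y) = 128 + 256 * (128 * y) := by ring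
    have h3 : (d + (128 - m)) &&& 128 = 128 * if m ≤ d then 1 else 0 := by
      have h4 : ∀ d < 256, d &&& 128 = 128 * if 128 ≤ d then 1 else 0 := by decide +kernel
      rw [h4 _ (by omega)]
      congr 2
      exact propext (by omega)
    rw [h1, h2, land_add_mul _ _ _ _ (by omega) (by omega), ih, h3]
    ring

lemma countGE_ofDigits {m : ℕ} (hm : 1 ≤ m) (hm' : m ≤ 128) {l : List ℕ}
    (hl : ∀ d ∈ l, d < 128) (hlen : l.length = 120) :
    countGE m (Nat.ofDigits 256 l) = l.countP (m ≤ ·) := by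
  have h1 : packedOnes = Nat.ofDigits 256 (List.replicate l.length 1) := by
    rw [hlen]; decide +kernel
  have h2 := Nat.modEq_digits_sum 255
  rw [countGE, h1, land_ofDigits hm hm' l hl, Nat.mul_div_cancel_left _ (by norm_num),
    Nat.ofDigits_mod]
  have h3 : 256 % 255 = 1 := rfl
  have h4 : (l.map fun d => if m ≤ d then 1 else 0).sum = l.countP (m ≤ ·) := by
    clear hl hlen h1
    induction l with
    | nil => rfl
    | cons d l ih => simp [List.countP_cons, ih, add_comm]
  rw [h3, Nat.ofDigits_one, h4, Nat.mod_eq_of_lt]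
  exact (List.countP_le_length).trans_lt (by omega)

lemma labelCheck_spec (l : List ℕ) (S k o : ℕ) (h : labelCheck l S k o = true) (as : List ℕ)
    (hlen : as.length = l.length) (has : ∀ a ∈ as, a ≤ 3) :
    countGE 2 (S + (List.zipWith (· * ·) as l).sum) + (if 1 ∈ as then 1 else o) +
      2 * countGE 1 (S + (List.zipWith (· * ·) as l).sum) ≤
    countGE 3 (S + (List.zipWith (· * ·) as l).sum) + 240 + (k + as.countP (· ≠ 3)) := by
  induction l generalizing S k o as with
  | nil =>
    obtain rfl := List.length_eq_zero_iff.1 hlen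
    simpa [labelCheck] using h
  | cons c l ih =>
    obtain _ | ⟨a, as⟩ := as
    · simp at hlen
    simp only [labelCheck, Bool.and_eq_true] at h
    obtain ⟨⟨⟨h0, h1⟩, h2⟩, h3⟩ := h
    have hlen' : as.length = l.length := by simpa using hlen
    have has' : ∀ a ∈ as, a ≤ 3 := fun a ha => has a (by simp [ha])
    have ha : a ≤ 3 := has a (by simp)
    interval_cases a
    · have := ih _ _ _ h0 as hlen' has'
      simpa [add_assoc, add_comm, add_left_comm] using this
    · have := ih _ _ _ h1 as hlen' has'
      simpa [add_assoc, add_comm, add_left_comm] using this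
    · have := ih _ _ _ h2 as hlen' has'
      simpa [add_assoc, add_comm, add_left_comm] using this
    · have := ih _ _ _ h3 as hlen' has'
      simpa [add_assoc, add_comm, add_left_comm] using this

end SerreE8

namespace SerreE8

lemma sum_mul_ofDigits (a : Fin 8 → ℕ) (f : Fin 8 → ℕ → ℕ) (l : List ℕ) :
    ∑ i, a i * Nat.ofDigits 256 (l.map (f i)) =
      Nat.ofDigits 256 (l.map fun n => ∑ i, a i * f i n) := by
  induction l with
  | nil => simp
  | cons n l ih =>
    simp only [List.map_cons, Nat.ofDigits_cons, mul_add, Finset.sum_add_distrib, ← ih,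
      Finset.mul_sum]
    congr 1
    exact Finset.sum_congr rfl fun i _ => by ring

/-- The number of positive roots on which a labelling of the Dynkin diagram takes the value `k`. -/
def labelCount (a : Fin 8 → ℕ) (k : ℤ) : ℕ := posRoots.countP fun v => ∑ i, v i * (a i : ℤ) = k

/-- The digit of index `i` in base 8. -/
def octal (i : Fin 8) (n : ℕ) : ℕ := (n >>> (3 * (i : ℕ))) % 8

lemma packedRoots_eq :
    packedRoots = List.ofFn fun i => Nat.ofDigits 256 (rootCodes.map (octal i)) := by
  decide +kernel

lemma sum_octal_lt : ∀ n ∈ rootCodes, ∑ i, octal i n < 40 := by decide +kernel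

lemma length_rootCodes : rootCodes.length = 120 := rfl

lemma sum_zipWith_ofFn (a b : Fin 8 → ℕ) :
    (List.zipWith (· * ·) (List.ofFn a) (List.ofFn b)).sum = ∑ i, a i * b i := by
  simp [List.ofFn_succ, Fin.sum_univ_succ]

lemma countP_ofFn_ne (a : Fin 8 → ℕ) :
    (List.ofFn a).countP (· ≠ 3) = (Finset.univ.filter fun i => a i ≠ 3).card := by
  rw [Finset.card_filter, Fin.sum_univ_eight]
  simp [List.ofFn_succ, List.countP_cons]
  ring

lemma countP_two_le (l : List ℕ) : l.countP (2 ≤ ·) = l.countP (· = 2) + l.countP (3 ≤ ·) := by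
  induction l with
  | nil => rfl
  | cons d l ih =>
    simp only [List.countP_cons, ih, decide_eq_true_eq]
    split_ifs <;> omega

lemma countP_one_le (l : List ℕ) : l.countP (1 ≤ ·) + l.countP (· = 0) = l.length := by
  induction l with
  | nil => rfl
  | cons d l ih =>
    simp only [List.countP_cons, List.length_cons, decide_eq_true_eq]
    split_ifs <;> omega

lemma labelCount_eq (a : Fin 8 → ℕ) (k : ℕ) :
    labelCount a k = (rootCodes.map fun n => ∑ i, a i * octal i n).countP (· = k) := by
  rw [labelCount, posRoots, List.countP_map, List.countP_map]
  congr 1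
  funext n
  simp only [Function.comp_apply, decide_eq_decide]
  rw [← Nat.cast_inj (R := ℤ)]
  simp [octal, digits, mul_comm]

lemma labelCount_bound (a : Fin 8 → ℕ) (ha : ∀ i, a i ≤ 3) :
    labelCount a 2 + (if ∃ i, a i = 1 then 1 else 0) ≤
      2 * labelCount a 0 + (Finset.univ.filter fun i => a i ≠ 3).card := by
  have h := labelCheck_spec _ _ _ _ labelCheck_eq (List.ofFn a)
    (by rw [packedRoots_eq, List.length_ofFn, List.length_ofFn]) (fun x hx => by
      obtain ⟨i, rfl⟩ := (List.mem_ofFn' a x).1 hx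
      exact ha i)
  rw [packedRoots_eq, sum_zipWith_ofFn, sum_mul_ofDigits] at h
  have h2 := labelCount_eq a 2
  have h0 := labelCount_eq a 0
  have hlen : (rootCodes.map fun n => ∑ i, a i * octal i n).length = 120 := by
    rw [List.length_map, length_rootCodes]
  have hw : ∀ d ∈ rootCodes.map fun n => ∑ i, a i * octal i n, d < 128 := by
    intro d hd
    obtain ⟨n, hn, rfl⟩ := List.mem_map.1 hd
    have h2 : ∑ i, a i * octal i n ≤ ∑ i, 3 * octal i n :=
      Finset.sum_le_sum fun i _ => Nat.mul_le_mul_right _ (ha i)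
    rw [← Finset.mul_sum] at h2
    have := sum_octal_lt n hn
    omega
  generalize (rootCodes.map fun n => ∑ i, a i * octal i n) = l at *
  have h4 : 1 ∈ List.ofFn a ↔ ∃ i, a i = 1 := List.mem_ofFn' a 1
  have h5 := countP_two_le l
  have h6 := countP_one_le l
  rw [zero_add, zero_add, countP_ofFn_ne] at h
  iterate 3 rw [countGE_ofDigits (by norm_num) (by norm_num) hw hlen] at h
  simp only [h4] at h
  push_cast at h2 h0
  generalize (if ∃ i, a i = 1 then 1 else 0) = o at *
  omega

end SerreE8

namespace SerreE8

lemma refl_mem_rootFinset {v : Fin 8 → ℤ} (hv : v ∈ rootFinset) (i : Fin 8) :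
    refl i v ∈ rootFinset := by
  have key {u : Fin 8 → ℤ} (hu : u ∈ posRoots) : refl i u ∈ rootFinset := by
    by_cases h : u = Pi.single i 1
    · rw [h, refl_single, mem_rootFinset, neg_neg]
      exact Or.inr (single_mem_posRoots i)
    · exact mem_rootFinset.2 (Or.inl (refl_mem_posRoots hu i h))
  rcases mem_rootFinset.1 hv with h | h
  · exact key h
  · have := key h
    rw [refl_neg, mem_rootFinset, neg_neg] at this
    exact mem_rootFinset.2 this.symm

/-- A simple reflection as an automorphism of the root lattice. -/
def reflEquiv (i : Fin 8) : (Fin 8 → ℤ) ≃+ (Fin 8 → ℤ) where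
  toFun := refl i
  invFun := refl i
  left_inv := refl_refl i
  right_inv := refl_refl i
  map_add' := refl_add i

/-- Any set of vectors meeting its negative trivially can be moved off the simple roots by an
element of the Weyl group. -/
lemma exists_forall_not_apply_single (P : (Fin 8 → ℤ) → Prop) (hP : ∀ v, P v → ¬ P (-v)) :
    ∃ w : (Fin 8 → ℤ) ≃+ (Fin 8 → ℤ), (∀ v ∈ rootFinset, w v ∈ rootFinset) ∧
      ∀ i, ¬ P (w (Pi.single i 1)) := by
  classical
  induction hn : (posRoots.toFinset.filter P).card using Nat.strong_induction_on generalizing P with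
  | _ n ih =>
    subst hn
    by_cases! hex : ∀ i, ¬ P (Pi.single i 1)
    · exact ⟨AddEquiv.refl _, fun _ h => h, hex⟩
    obtain ⟨i, hi⟩ := hex
    have hmem : Pi.single i 1 ∈ posRoots.toFinset.filter P := by
      simp [single_mem_posRoots, hi]
    have hlt : (posRoots.toFinset.filter fun v => P (refl i v)).card <
        (posRoots.toFinset.filter P).card := by
      refine lt_of_le_of_lt ?_ (Finset.card_erase_lt_of_mem hmem)
      refine Finset.card_le_card_of_injOn (refl i) ?_ ?_
      · intro v hv
        rw [Finset.mem_coe, Finset.mem_filter, List.mem_toFinset] at hv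
        have hvi : v ≠ Pi.single i 1 := by
          rintro rfl
          rw [refl_single] at hv
          exact hP _ hi hv.2
        rw [Finset.mem_coe, Finset.mem_erase, Finset.mem_filter, List.mem_toFinset]
        refine ⟨fun h => ?_, refl_mem_posRoots hv.1 i hvi, hv.2⟩
        have h1 : v = -Pi.single i 1 := by rw [← refl_refl i v, h, refl_single]
        have h2 := nonneg_of_mem_posRoots hv.1 i
        rw [h1] at h2
        simp at h2
      · exact fun u _ v _ h => by rw [← refl_refl i u, h, refl_refl]
    obtain ⟨w, hw, hwP⟩ := ih _ hlt
      (fun v => P (refl i v)) (fun v hv => by rw [refl_neg]; exact hP _ hv) rfl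
    exact ⟨w.trans (reflEquiv i), fun v hv => refl_mem_rootFinset (hw v hv) i, hwP⟩

end SerreE8

namespace SerreE8

lemma map_eq_sum_single {M : Type*} [AddCommGroup M] (g : (Fin 8 → ℤ) →+ M) (v : Fin 8 → ℤ) :
    g v = ∑ i, v i • g (Pi.single i 1) := by
  have := LinearMap.pi_apply_eq_sum_univ g.toIntLinearMap v
  simp only [AddMonoidHom.coe_toIntLinearMap] at this
  rw [this]
  refine Finset.sum_congr rfl fun i _ => ?_
  congr 2
  ext j
  simp [Pi.single_apply, eq_comm]

lemma labelCount_eq_card (a : Fin 8 → ℕ) (k : ℤ) : labelCount a k =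
    (posRoots.toFinset.filter fun v => ∑ i, v i * (a i : ℤ) = k).card := by
  rw [labelCount, List.countP_eq_length_filter,
    ← List.toFinset_card_of_nodup (posRoots_nodup.filter _), List.toFinset_filter]
  refine congrArg Finset.card (Finset.ext fun v => ?_)
  rw [Finset.mem_filter, Finset.mem_filter, decide_eq_true_eq]

open Classical in
lemma two_mul_card_le {M : Type*} [AddCommGroup M] {P Q : Finset M}
    (hPQ : ∀ v ∈ P, v ∈ Q ∧ -v ∈ Q) (hP : ∀ v ∈ P, -v ∉ P) : 2 * P.card ≤ Q.card := by
  have hdisj : Disjoint P (P.image (-·)) := by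
    rw [Finset.disjoint_left]
    intro v hv hv'
    obtain ⟨u, hu, rfl⟩ := Finset.mem_image.1 hv'
    exact hP u hu hv
  calc 2 * P.card = (P ∪ P.image (-·)).card := by
        rw [Finset.card_union_of_disjoint hdisj, Finset.card_image_of_injective _ neg_injective,
          two_mul]
    _ ≤ _ := Finset.card_le_card fun v hv => by
        rcases Finset.mem_union.1 hv with hv | hv
        · exact (hPQ v hv).1
        · obtain ⟨u, hu, rfl⟩ := Finset.mem_image.1 hv
          exact (hPQ u hu).2

section

variable {τ : (Fin 8 → ℤ) →+ ℝ} {η : (Fin 8 → ℤ) →+ ℤ} (hτ : ∀ i, 0 ≤ τ (Pi.single i 1))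
  (hη : ∀ i, τ (Pi.single i 1) = 0 → 0 ≤ η (Pi.single i 1))
include hτ

lemma apply_eq_zero_iff_of_nonneg {v : Fin 8 → ℤ} (hv : 0 ≤ v) :
    τ v = 0 ↔ ∀ i, v i ≠ 0 → τ (Pi.single i 1) = 0 := by
  rw [map_eq_sum_single, Finset.sum_eq_zero_iff_of_nonneg fun i _ => zsmul_nonneg (hτ i) (hv i)]
  simp only [Finset.mem_univ, true_imp_iff, smul_eq_zero, or_iff_not_imp_left]

open Classical in
/-- The labels of simple roots, truncated at `3`. -/
noncomputable def truncLabel (τ : (Fin 8 → ℤ) →+ ℝ) (η : (Fin 8 → ℤ) →+ ℤ) (i : Fin 8) : ℕ :=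
  if τ (Pi.single i 1) = 0 then min (η (Pi.single i 1)).toNat 3 else 3

include hη

lemma apply_eq_of_truncLabel {v : Fin 8 → ℤ} (hv : 0 ≤ v) {k : ℤ} (hk : k < 3) :
    ∑ i, v i * (truncLabel τ η i : ℤ) = k ↔ τ v = 0 ∧ η v = k := by
  by_cases hbig : ∃ i, v i ≠ 0 ∧ truncLabel τ η i = 3
  · obtain ⟨i, hi, hi3⟩ := hbig
    have hvi : 1 ≤ v i := lt_of_le_of_ne (hv i) (Ne.symm hi)
    have h1 : v i * (truncLabel τ η i : ℤ) ≤ ∑ i, v i * (truncLabel τ η i : ℤ) :=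
      Finset.single_le_sum (f := fun i => v i * (truncLabel τ η i : ℤ))
        (fun j _ => mul_nonneg (hv j) (by positivity)) (Finset.mem_univ i)
    rw [hi3] at h1
    push_cast at h1
    refine iff_of_false (by intro h; omega) ?_
    rintro ⟨h2, h3⟩
    rw [apply_eq_zero_iff_of_nonneg hτ hv] at h2
    have h4 : v i * η (Pi.single i 1) ≤ ∑ i, v i * η (Pi.single i 1) := by
      refine Finset.single_le_sum (f := fun i => v i * η (Pi.single i 1))
        (fun j _ => ?_) (Finset.mem_univ i)
      by_cases hj : v j = 0
      · rw [hj, zero_mul]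
      · exact mul_nonneg (hv j) (hη j (h2 j hj))
    rw [map_eq_sum_single] at h3
    simp only [smul_eq_mul] at h3
    rw [truncLabel, if_pos (h2 i hi)] at hi3
    have h5 : 3 ≤ η (Pi.single i 1) := by omega
    nlinarith
  · push Not at hbig
    have hτv : τ v = 0 := by
      rw [apply_eq_zero_iff_of_nonneg hτ hv]
      intro i hi
      by_contra hne
      exact hbig i hi (by rw [truncLabel, if_neg hne])
    have hηv : η v = ∑ i, v i * (truncLabel τ η i : ℤ) := by
      rw [map_eq_sum_single]
      refine Finset.sum_congr rfl fun i _ => ?_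
      by_cases hi : v i = 0
      · rw [hi, zero_smul, zero_mul]
      have h0 := (apply_eq_zero_iff_of_nonneg hτ hv).1 hτv i hi
      have h1 := hbig i hi
      have h2 := hη i h0
      rw [truncLabel, if_pos h0] at h1 ⊢
      rw [smul_eq_mul]
      congr 1
      omega
    rw [hηv]
    simp [hτv]

open Classical in
lemma even_of_card_le (hcard : (rootFinset.filter fun v => τ v = 0 ∧ η v = 0).card +
      (Finset.univ.filter fun i => τ (Pi.single i 1) = 0).card ≤
      (rootFinset.filter fun v => τ v = 0 ∧ η v = 2).card)
    {v : Fin 8 → ℤ} (hv : v ∈ rootFinset) (hv0 : τ v = 0) : Even (η v) := by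
  set a := truncLabel τ η with ha
  have ha3 (i : Fin 8) : a i ≤ 3 := by
    rw [ha, truncLabel]; split_ifs <;> simp
  have hbound := labelCount_bound a ha3
  have h2 : (rootFinset.filter fun v => τ v = 0 ∧ η v = 2).card ≤ labelCount a 2 := by
    rw [labelCount_eq_card]
    refine Finset.card_le_card fun v hv => ?_
    rw [Finset.mem_filter] at hv ⊢
    obtain ⟨hv, h1, h2⟩ := hv
    rcases mem_rootFinset.1 hv with h | h
    · exact ⟨List.mem_toFinset.2 h, (apply_eq_of_truncLabel hτ hη (nonneg_of_mem_posRoots h)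
        (by norm_num)).2 ⟨h1, h2⟩⟩
    · have h3 := (apply_eq_of_truncLabel hτ hη (nonneg_of_mem_posRoots h) (k := -2)
        (by norm_num)).2 ⟨by rw [map_neg, h1, neg_zero], by rw [map_neg, h2]⟩
      have h4 : 0 ≤ ∑ i, (-v) i * (truncLabel τ η i : ℤ) :=
        Finset.sum_nonneg fun i _ => mul_nonneg (nonneg_of_mem_posRoots h i) (Int.natCast_nonneg _)
      omega
  have h0 : 2 * labelCount a 0 ≤ (rootFinset.filter fun v => τ v = 0 ∧ η v = 0).card := by
    rw [labelCount_eq_card]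
    refine two_mul_card_le (fun v hv => ?_) (fun v hv hv' => ?_)
    · rw [Finset.mem_filter, List.mem_toFinset] at hv
      obtain ⟨h1, h2⟩ := (apply_eq_of_truncLabel hτ hη (nonneg_of_mem_posRoots hv.1)
        (by norm_num)).1 hv.2
      rw [Finset.mem_filter, Finset.mem_filter, map_neg, map_neg, h1, h2]
      exact ⟨⟨mem_rootFinset.2 (Or.inl hv.1), rfl, rfl⟩,
        mem_rootFinset.2 (Or.inr (by rw [neg_neg]; exact hv.1)), neg_zero, neg_zero⟩
    · rw [Finset.mem_filter, List.mem_toFinset] at hv hv'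
      exact ne_zero_of_mem_posRoots hv.1 (le_antisymm (neg_nonneg.1 (nonneg_of_mem_posRoots hv'.1))
        (nonneg_of_mem_posRoots hv.1))
  have hsub : (Finset.univ.filter fun i => a i ≠ 3) ⊆
      Finset.univ.filter fun i => τ (Pi.single i 1) = 0 := by
    intro i hi
    rw [Finset.mem_filter] at hi ⊢
    refine ⟨hi.1, ?_⟩
    by_contra hne
    exact hi.2 (by rw [ha, truncLabel, if_neg hne])
  have hle := Finset.card_le_card hsub
  have hone : ¬ ∃ i, a i = 1 := by
    intro h
    rw [if_pos h] at hbound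
    omega
  have heq := Finset.eq_of_subset_of_card_le hsub (by split_ifs at hbound; omega)
  have hsimple (i : Fin 8) (hi : τ (Pi.single i 1) = 0) : Even (η (Pi.single i 1)) := by
    have h3 : i ∈ Finset.univ.filter fun i => a i ≠ 3 := by
      rw [heq]; simp [hi]
    rw [Finset.mem_filter] at h3
    have h4 : a i ≠ 1 := fun h => hone ⟨i, h⟩
    have h5 := h3.2
    rw [ha, truncLabel, if_pos hi] at h4 h5
    have h6 := hη i hi
    have : η (Pi.single i 1) = 0 ∨ η (Pi.single i 1) = 2 := by omega
    rcases this with h | h <;> rw [h] <;> decide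
  have hpos {u : Fin 8 → ℤ} (hu : u ∈ posRoots) (hu0 : τ u = 0) : Even (η u) := by
    rw [map_eq_sum_single]
    refine Finset.even_sum _ fun i _ => ?_
    by_cases hi : u i = 0
    · rw [hi, zero_smul]; exact Even.zero
    · rw [smul_eq_mul]
      exact (hsimple i ((apply_eq_zero_iff_of_nonneg hτ (nonneg_of_mem_posRoots hu)).1 hu0 i
        hi)).mul_left _
  rcases mem_rootFinset.1 hv with h | h
  · exact hpos h hv0
  · have := hpos h (by rw [map_neg, hv0, neg_zero])
    rwa [map_neg, even_neg] at this

end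

open Classical in
/-- The combinatorial heart of the matter, for arbitrary real and integral functionals on the root
lattice. -/
theorem even_of_forall_card_le (τ : (Fin 8 → ℤ) →+ ℝ) (η : (Fin 8 → ℤ) →+ ℤ)
    (hcard : ∀ w : (Fin 8 → ℤ) ≃+ (Fin 8 → ℤ), (∀ v ∈ rootFinset, w v ∈ rootFinset) →
      (rootFinset.filter fun v => τ v = 0 ∧ η v = 0).card +
        (Finset.univ.filter fun i => τ (w (Pi.single i 1)) = 0).card ≤
      (rootFinset.filter fun v => τ v = 0 ∧ η v = 2).card)
    {v : Fin 8 → ℤ} (hv : v ∈ rootFinset) (hv0 : τ v = 0) : Even (η v) := by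
  obtain ⟨w, hw, hwP⟩ := exists_forall_not_apply_single
    (fun v => τ v < 0 ∨ τ v = 0 ∧ η v < 0) (fun v hv => by
      rw [map_neg, map_neg]
      rcases hv with hv | ⟨hv, hv'⟩
      · rintro (h | ⟨h, -⟩) <;> linarith
      · rintro (h | ⟨-, h⟩)
        · linarith
        · omega)
  have himage : rootFinset.image w = rootFinset := by
    refine Finset.eq_of_subset_of_card_le (fun v hv => ?_) ?_
    · obtain ⟨u, hu, rfl⟩ := Finset.mem_image.1 hv
      exact hw u hu
    · rw [Finset.card_image_of_injective _ w.injective]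
  have hfilter (k : ℤ) : (rootFinset.filter fun v => τ v = 0 ∧ η v = k).card =
      (rootFinset.filter fun v => τ (w v) = 0 ∧ η (w v) = k).card := by
    conv_lhs => rw [← himage]
    rw [Finset.filter_image, Finset.card_image_of_injective _ w.injective]
  obtain ⟨u, hu, rfl⟩ := Finset.mem_image.1 (himage ▸ hv)
  have := hcard w hw
  rw [hfilter, hfilter] at this
  refine even_of_card_le (τ := τ.comp w.toAddMonoidHom) (η := η.comp w.toAddMonoidHom)
    (fun i => ?_) (fun i h0 => ?_) this hu hv0
  · exact not_lt.1 fun h => hwP i (Or.inl h)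
  · exact not_lt.1 fun h => hwP i (Or.inr ⟨h0, h⟩)

end SerreE8

namespace SerreE8

open Module LieAlgebra

/-- The complex functional on the root lattice attached to a combination of simple coroots. -/
noncomputable def corootEval (c : Fin 8 → ℂ) : (Fin 8 → ℤ) →+ ℂ where
  toFun v := ∑ i, c i * (pair i v : ℂ)
  map_zero' := by simp [pair_zero]
  map_add' v w := by simp [pair_add, mul_add, Finset.sum_add_distrib]

lemma corootEval_apply (c : Fin 8 → ℂ) (v : Fin 8 → ℤ) :
    corootEval c v = ∑ i, c i * (pair i v : ℂ) := rfl

lemma eq_zero_of_corootEval_eq_zero (w : (Fin 8 → ℤ) ≃+ (Fin 8 → ℤ)) {c : Fin 8 → ℂ}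
    (h : ∀ i, corootEval c (w (Pi.single i 1)) = 0) : c = 0 := by
  refine eq_zero_of_forall_pair_eq_zero fun j => ?_
  have h1 : ((corootEval c).comp w.toAddMonoidHom) (w.symm (Pi.single j 1)) = 0 := by
    rw [map_eq_sum_single]
    refine Finset.sum_eq_zero fun i _ => ?_
    rw [show ((corootEval c).comp w.toAddMonoidHom) (Pi.single i 1) = 0 from h i, smul_zero]
  have h2 : corootEval c (Pi.single j 1) = 0 := by simpa using h1
  simpa [corootEval_apply, pair_single] using h2

lemma exists_real_functional (g : (Fin 8 → ℤ) →+ ℂ) (s : Finset (Fin 8 → ℤ)) :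
    ∃ τ : (Fin 8 → ℤ) →+ ℝ, ∀ v ∈ s, τ v = 0 ↔ g v = 0 := by
  obtain ⟨r, hr⟩ := Infinite.exists_notMem_finset (s.image fun v => (g v).re / (g v).im)
  refine ⟨{ toFun := fun v => (g v).re - r * (g v).im
            map_zero' := by simp
            map_add' := fun v w => by simp; ring }, fun v hv => ⟨fun h => ?_, fun h => ?_⟩⟩
  · change (g v).re - r * (g v).im = 0 at h
    have him : (g v).im = 0 := by
      by_contra hne
      exact hr (Finset.mem_image.2 ⟨v, hv, by rw [div_eq_iff hne]; linarith⟩)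
    rw [him, mul_zero, sub_zero] at h
    exact Complex.ext h him
  · change (g v).re - r * (g v).im = 0
    simp [h]

lemma finrank_biSup {ι V : Type*} [AddCommGroup V] [Module ℂ V] [FiniteDimensional ℂ V]
    {p : ι → Submodule ℂ V} (hp : iSupIndep p) (s : Finset ι) :
    finrank ℂ ↥(⨆ i ∈ s, p i) = ∑ i ∈ s, finrank ℂ (p i) := by
  classical
  induction s using Finset.induction_on with
  | empty => simp
  | insert i s hi ih =>
    rw [Finset.iSup_insert, Finset.sum_insert hi, ← ih,
      ← Submodule.finrank_sup_add_finrank_inf_eq]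
    have : Disjoint (p i) (⨆ j ∈ s, p j) :=
      hp.disjoint_biSup (y := (s : Set ι)) hi
    rw [this.eq_bot, finrank_bot, add_zero]

variable {L : Type*} [LieRing L] [LieAlgebra ℂ L]

namespace IsSerreSystem

variable {H E F : Fin 8 → L} (hS : IsSerreSystem H E F)
include hS

lemma lie_sum_smul (c : Fin 8 → ℂ) {v : Fin 8 → ℤ} {x : L} (hx : x ∈ wtSpace H v) :
    ⁅∑ i, c i • H i, x⁆ = corootEval c v • x := by
  simp [sum_lie, hS.lie_h hx, corootEval_apply, smul_smul, Finset.sum_smul]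

lemma lie_sum_sum (c d : Fin 8 → ℂ) : ⁅∑ i, c i • H i, ∑ i, d i • H i⁆ = 0 := by
  simp [sum_lie, lie_sum, hS.lie_h_h]

open Classical in
lemma ker_inf_eigenspace_eq (a b : Fin 8 → ℂ) (μ : ℂ) :
    LinearMap.ker (ad ℂ L (∑ i, a i • H i)) ⊓ (ad ℂ L (∑ i, b i • H i)).eigenspace μ =
      ⨆ v ∈ (insert 0 rootFinset).filter fun v => corootEval a v = 0 ∧ corootEval b v = μ,
        wtSpace H v := by
  have := hS.finiteDimensional
  apply le_antisymm
  · rw [Submodule.eq_iSup_inf_genEigenspace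
      (p := LinearMap.ker (ad ℂ L (∑ i, a i • H i)) ⊓ (ad ℂ L (∑ i, b i • H i)).eigenspace μ)
      (f := ad ℂ L (sepElt H)) 1 ?_ hS.iSup_eigenspace]
    · refine iSup_le fun ν => ?_
      rintro x ⟨⟨hxa, hxb⟩, hx⟩
      by_cases hx0 : x = 0
      · rw [hx0]; exact zero_mem _
      replace hx : x ∈ (ad ℂ L (sepElt H)).eigenspace ν := hx
      by_cases hν : ν ∈ Set.range sepEval
      · obtain ⟨v, rfl⟩ := hν
        have hxv : x ∈ wtSpace H v := hx
        have hbot : wtSpace H v ≠ ⊥ := fun h => hx0 (by simpa [h] using hxv)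
        have hxa' : corootEval a v • x = 0 := by rw [← hS.lie_sum_smul a hxv]; exact hxa
        have hxb' : corootEval b v • x = μ • x := by
          rw [← hS.lie_sum_smul b hxv]; exact Module.End.mem_eigenspace_iff.1 hxb
        have hv : v ∈ insert 0 rootFinset := by
          rw [Finset.mem_insert]
          by_cases hv : v = 0
          · exact Or.inl hv
          · exact Or.inr (hS.mem_rootFinset_and_line hv hbot).1
        exact Submodule.mem_iSup_of_mem v (Submodule.mem_iSup_of_mem (Finset.mem_filter.2
          ⟨hv, (smul_eq_zero.1 hxa').resolve_right hx0, smul_left_injective ℂ hx0 hxb'⟩) hxv)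
      · rw [hS.eigenspace_eq_bot hν, Submodule.mem_bot] at hx
        exact absurd hx hx0
    · rintro x ⟨hxa, hxb⟩
      rw [SetLike.mem_coe, LinearMap.mem_ker, ad_apply] at hxa
      rw [SetLike.mem_coe, Module.End.mem_eigenspace_iff, ad_apply] at hxb
      constructor
      · rw [SetLike.mem_coe, LinearMap.mem_ker, ad_apply, ad_apply, leibniz_lie, hxa, sepElt,
          hS.lie_sum_sum]
        simp
      · rw [SetLike.mem_coe, Module.End.mem_eigenspace_iff, ad_apply, ad_apply, leibniz_lie, hxb,
          sepElt, hS.lie_sum_sum]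
        simp
  · refine iSup₂_le fun v hv x hx => ?_
    obtain ⟨-, h1, h2⟩ := Finset.mem_filter.1 hv
    constructor
    · rw [SetLike.mem_coe, LinearMap.mem_ker, ad_apply, hS.lie_sum_smul a hx, h1, zero_smul]
    · rw [SetLike.mem_coe, Module.End.mem_eigenspace_iff, ad_apply, hS.lie_sum_smul b hx, h2]

variable [Nontrivial L]

open Classical in
lemma finrank_ker_inf_eigenspace (a b : Fin 8 → ℂ) (μ : ℂ) :
    finrank ℂ ↥(LinearMap.ker (ad ℂ L (∑ i, a i • H i)) ⊓
      (ad ℂ L (∑ i, b i • H i)).eigenspace μ) =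
      (if μ = 0 then 8 else 0) +
        (rootFinset.filter fun v => corootEval a v = 0 ∧ corootEval b v = μ).card := by
  have := hS.finiteDimensional
  have hsum : ∑ v ∈ rootFinset.filter (fun v => corootEval a v = 0 ∧ corootEval b v = μ),
      finrank ℂ (wtSpace H v) =
      (rootFinset.filter fun v => corootEval a v = 0 ∧ corootEval b v = μ).card := by
    rw [Finset.card_eq_sum_ones]
    exact Finset.sum_congr rfl fun v hv => hS.finrank_wtSpace (Finset.mem_filter.1 hv).1
  rw [hS.ker_inf_eigenspace_eq, finrank_biSup (iSupIndep_wtSpace H), Finset.filter_insert, map_zero,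
    map_zero]
  by_cases hμ : μ = 0
  · subst hμ
    rw [if_pos ⟨rfl, rfl⟩, Finset.sum_insert, hS.finrank_wtSpace_zero, hsum, if_pos rfl]
    exact fun h => ne_zero_of_mem_rootFinset (Finset.mem_filter.1 h).1 rfl
  · rw [if_neg fun h => hμ h.2.symm, hsum, if_neg hμ, zero_add]

open Classical in
lemma finrank_add_card_le {T : Submodule ℂ L} (hT : T ≤ Submodule.span ℂ (Set.range H))
    {a : Fin 8 → ℂ} (ha : ∀ t ∈ T, ∀ x : L, ⁅∑ i, a i • H i, x⁆ = 0 → ⁅t, x⁆ = 0)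
    {w : (Fin 8 → ℤ) ≃+ (Fin 8 → ℤ)} (hw : ∀ v ∈ rootFinset, w v ∈ rootFinset) :
    finrank ℂ T + (Finset.univ.filter fun i => corootEval a (w (Pi.single i 1)) = 0).card ≤ 8 := by
  have := hS.finiteDimensional
  set J := Finset.univ.filter fun i => corootEval a (w (Pi.single i 1)) = 0 with hJ
  let Φ : (Fin 8 → ℂ) →ₗ[ℂ] L := Fintype.linearCombination ℂ H
  have hΦ (c : Fin 8 → ℂ) : Φ c = ∑ i, c i • H i := rfl
  have hTΦ : (T.comap Φ).map Φ = T := by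
    rw [Submodule.map_comap_eq, inf_eq_right]
    exact hT.trans (Fintype.range_linearCombination ℂ H).ge
  have h1 : finrank ℂ T ≤ finrank ℂ (T.comap Φ) := by
    conv_lhs => rw [← hTΦ]
    exact Submodule.finrank_map_le _ _
  let Ψ : (Fin 8 → ℂ) →ₗ[ℂ] ({i // i ∉ J} → ℂ) :=
    { toFun := fun c i => corootEval c (w (Pi.single i 1))
      map_add' := fun c d => by
        ext i; simp [corootEval_apply, add_mul, Finset.sum_add_distrib]
      map_smul' := fun r c => by
        ext i; simp [corootEval_apply, Finset.mul_sum, mul_assoc] }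
  have hinj : Function.Injective (Ψ.domRestrict (T.comap Φ)) := by
    rw [← LinearMap.ker_eq_bot, LinearMap.ker_eq_bot']
    rintro ⟨c, hc⟩ h0
    refine Subtype.ext (eq_zero_of_corootEval_eq_zero w fun i => ?_)
    by_cases hi : i ∈ J
    · have hroot := hw _ (single_mem_rootFinset i)
      obtain ⟨x, hx, hx0⟩ := Submodule.exists_mem_ne_zero_of_ne_bot (hS.wtSpace_ne_bot hroot)
      have h2 := ha _ hc x (by
        rw [hS.lie_sum_smul a hx, (Finset.mem_filter.1 hi).2, zero_smul])
      rw [hΦ, hS.lie_sum_smul c hx] at h2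
      exact (smul_eq_zero.1 h2).resolve_right hx0
    · exact congrFun h0 ⟨i, hi⟩
  have h2 := LinearMap.finrank_le_finrank_of_injective hinj
  rw [Module.finrank_fintype_fun_eq_card, Fintype.card_subtype_compl, Fintype.card_fin,
    Fintype.card_coe] at h2
  have h3 : J.card ≤ 8 := (Finset.card_le_univ J).trans (Fintype.card_fin 8).le
  omega

end IsSerreSystem

end SerreE8

namespace SerreE8

open Module LieAlgebra LieSubalgebra

lemma Sl2Ops.exists_int_eq {V : Type*} [AddCommGroup V] [Module ℂ V] [FiniteDimensional ℂ V]
    {h e f : End ℂ V} (S : Sl2Ops h e f) {μ : ℂ} {v : V} (hv : h v = μ • v) (hv0 : v ≠ 0) :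
    ∃ n : ℤ, μ = n := by
  by_contra hμ
  have h1 : h.eigenspace μ = ⊥ := by
    refine disjoint_self.1 ((Module.End.eigenspaces_iSupIndep h μ).mono_right
      (le_top.trans (S.iSup_eigenspace_h ▸ iSup_le fun n => ?_)))
    exact le_iSup₂_of_le (n : ℂ) (fun h => hμ ⟨n, h.symm⟩) le_rfl
  have h2 : v ∈ h.eigenspace μ := Module.End.mem_eigenspace_iff.2 hv
  rw [h1, Submodule.mem_bot] at h2
  exact hv0 h2

variable {L : Type*} [LieRing L] [LieAlgebra ℂ L]

namespace IsSerreSystem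

variable [Nontrivial L] {H E F : Fin 8 → L} (hS : IsSerreSystem H E F)
  {h e f : L} (hhe : ⁅h, e⁆ = (2 : ℂ) • e) (hhf : ⁅h, f⁆ = (-2 : ℂ) • f) (hef : ⁅e, f⁆ = h)
include hS hhe hhf hef

/-- The elements of weight zero in the centralizer of `e` which commute with `t₀` lie in a common
split Cartan subalgebra together with `h`. -/
lemma exists_isSerreSystem_of_pairCentralizer {T : Submodule ℂ L}
    (hTp : ∀ t ∈ T, ⁅h, t⁆ = 0 ∧ (ad ℂ L t).IsSemisimple) (hTT : ∀ s ∈ T, ∀ t ∈ T, ⁅s, t⁆ = 0) :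
    ∃ H' E' F' : Fin 8 → L, IsSerreSystem H' E' F' ∧ h ∈ Submodule.span ℂ (Set.range H') ∧
      T ≤ Submodule.span ℂ (Set.range H') := by
  have := hS.finiteDimensional
  have := hS.isKilling
  have S := sl2Ops_ad hhe hhf hef
  obtain ⟨x, -, hx⟩ := exists_engel_le (insert h (T : Set L)) (by
    rintro s (rfl | hs) t (rfl | ht)
    · exact lie_self _
    · exact (hTp t ht).1
    · rw [← lie_skew, (hTp s hs).1, neg_zero]
    · exact hTT s hs t ht)
  obtain ⟨H', E', F', hS', hspan⟩ := hS.exists_forall_mem_span x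
  refine ⟨H', E', F', hS', hspan h fun z hz => ?_, fun t ht => hspan t fun z hz => ?_⟩
  · have h1 : ⨆ μ, (ad ℂ L h).eigenspace μ = ⊤ := by
      rw [eq_top_iff, ← S.iSup_eigenspace_h]
      exact iSup_le fun n => le_iSup _ (n : ℂ)
    have h2 : z ∈ (ad ℂ L h).maxGenEigenspace 0 := hx h (Set.mem_insert _ _) hz
    rw [← eigenspace_eq_maxGenEigenspace h1, Module.End.mem_eigenspace_iff, zero_smul] at h2
    exact h2
  · exact (mem_engel_iff_of_isSemisimple (hTp t ht).2).1 (hx t (Set.mem_insert_of_mem _ ht) hz)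

/-- There is an element of the reductive part of the centralizer of `e` which acts injectively on
the odd part of `L`. -/
theorem exists_forall_odd_eq_zero : ∃ t₀ : L, ⁅e, t₀⁆ = 0 ∧ ⁅h, t₀⁆ = 0 ∧
    ∀ (n : ℤ) (x : L), Odd n → ⁅h, x⁆ = (n : ℂ) • x → ⁅t₀, x⁆ = 0 → x = 0 := by
  classical
  have := hS.finiteDimensional
  have := hS.isKilling
  have S := sl2Ops_ad hhe hhf hef
  obtain ⟨t₀, ⟨het₀, hft₀⟩, ht₀⟩ := exists_mem_pairCentralizer hhe hhf hef
  have hht₀ : ⁅h, t₀⁆ = 0 := by rw [← hef, lie_lie, het₀, hft₀]; simp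
  refine ⟨t₀, het₀, hht₀, fun n x hn hx hx₀ => ?_⟩
  set T : Submodule ℂ L := LinearMap.ker (ad ℂ L t₀) ⊓ (ad ℂ L h).eigenspace 0 ⊓
    LinearMap.ker (ad ℂ L e) with hT
  have hTm {t : L} (ht : t ∈ T) : ⁅t₀, t⁆ = 0 ∧ ⁅h, t⁆ = 0 ∧ t ∈ pairCentralizer e f := by
    obtain ⟨⟨h1, h2⟩, h3⟩ := ht
    rw [SetLike.mem_coe, Module.End.mem_eigenspace_iff, zero_smul] at h2
    exact ⟨h1, h2, h3, S.f_eq_zero_of_e_eq_zero h2 h3⟩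
  have hker {t : L} (ht : t ∈ T) {y : L} (hy : ⁅t₀, y⁆ = 0) : ⁅t, y⁆ = 0 :=
    (ht₀ t (hTm ht).2.2 (hTm ht).1).2 y hy
  obtain ⟨H', E', F', hS', hh, hTle⟩ := hS.exists_isSerreSystem_of_pairCentralizer hhe hhf hef
    (T := T) (fun t ht => ⟨(hTm ht).2.1, (ht₀ t (hTm ht).2.2 (hTm ht).1).1⟩)
    (fun s hs t ht => hker hs (hTm ht).1)
  have ht₀T : t₀ ∈ T := ⟨⟨lie_self _, Module.End.mem_eigenspace_iff.2 (by
    rw [zero_smul]; exact hht₀)⟩, het₀⟩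
  obtain ⟨a, ha⟩ := (Submodule.mem_span_range_iff_exists_fun ℂ).1 (hTle ht₀T)
  obtain ⟨b, hb⟩ := (Submodule.mem_span_range_iff_exists_fun ℂ).1 hh
  have hbint (i : Fin 8) : ∃ m : ℤ, corootEval b (Pi.single i 1) = m := by
    obtain ⟨y, hy, hy0⟩ := Submodule.exists_mem_ne_zero_of_ne_bot
      (hS'.wtSpace_ne_bot (single_mem_rootFinset i))
    exact S.exists_int_eq (v := y) (by
      rw [ad_apply, ← hb, hS'.lie_sum_smul b hy]) hy0
  choose m hm using hbint
  let η : (Fin 8 → ℤ) →+ ℤ :=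
    { toFun := fun v => ∑ i, v i * m i
      map_zero' := by simp
      map_add' := fun v w => by simp [add_mul, Finset.sum_add_distrib] }
  have hη (v : Fin 8 → ℤ) : corootEval b v = (η v : ℂ) := by
    rw [map_eq_sum_single, show η v = ∑ i, v i * m i from rfl]
    push_cast
    exact Finset.sum_congr rfl fun i _ => by rw [hm, zsmul_eq_mul]
  have hηk (v : Fin 8 → ℤ) (k : ℤ) : corootEval b v = (k : ℂ) ↔ η v = k := by
    rw [hη, Int.cast_inj]
  obtain ⟨τ, hτ⟩ := exists_real_functional (corootEval a) rootFinset
  have hUe : ∀ v ∈ LinearMap.ker (ad ℂ L t₀), ad ℂ L e v ∈ LinearMap.ker (ad ℂ L t₀) := by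
    intro v hv
    rw [LinearMap.mem_ker, ad_apply] at hv ⊢
    rw [ad_apply, leibniz_lie, hv, ← lie_skew t₀ e, het₀]; simp
  have hUf : ∀ v ∈ LinearMap.ker (ad ℂ L t₀), ad ℂ L f v ∈ LinearMap.ker (ad ℂ L t₀) := by
    intro v hv
    rw [LinearMap.mem_ker, ad_apply] at hv ⊢
    rw [ad_apply, leibniz_lie, hv, ← lie_skew t₀ f, hft₀]; simp
  have hdim := S.finrank_eigenspace_zero hUe hUf
  rw [← hT, ← ha, ← hb, hS'.finrank_ker_inf_eigenspace, hS'.finrank_ker_inf_eigenspace, if_pos rfl,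
    if_neg two_ne_zero] at hdim
  have hfilter (k : ℤ) : (rootFinset.filter fun v => τ v = 0 ∧ η v = k) =
      rootFinset.filter fun v => corootEval a v = 0 ∧ corootEval b v = (k : ℂ) :=
    Finset.filter_congr fun v hv => by rw [hτ v hv, hηk]
  have heven {v : Fin 8 → ℤ} (hv : v ∈ rootFinset) (hv0 : corootEval a v = 0) : Even (η v) := by
    refine even_of_forall_card_le τ η (fun w hw => ?_) hv ((hτ v hv).2 hv0)
    have h1 := hS'.finrank_add_card_le hTle (a := a) (fun t ht y hy => hker ht (ha ▸ hy)) hw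
    have h2 : (Finset.univ.filter fun i => τ (w (Pi.single i 1)) = 0) =
        Finset.univ.filter fun i => corootEval a (w (Pi.single i 1)) = 0 :=
      Finset.filter_congr fun i _ => hτ _ (hw _ (single_mem_rootFinset i))
    rw [hfilter, hfilter, h2, Int.cast_zero, Int.cast_ofNat]
    omega
  have hxmem : x ∈ LinearMap.ker (ad ℂ L (∑ i, a i • H' i)) ⊓
      (ad ℂ L (∑ i, b i • H' i)).eigenspace (n : ℂ) :=
    ⟨by rw [ha]; exact hx₀, by rw [hb]; exact Module.End.mem_eigenspace_iff.2 hx⟩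
  have hempty : ((insert 0 rootFinset).filter fun v =>
      corootEval a v = 0 ∧ corootEval b v = (n : ℂ)) = ∅ := by
    refine Finset.filter_eq_empty_iff.2 fun v hv ⟨h1, h2⟩ => ?_
    rw [hηk] at h2
    refine Int.not_even_iff_odd.2 hn (h2 ▸ ?_)
    rcases Finset.mem_insert.1 hv with rfl | hv
    · rw [map_zero]; exact Even.zero
    · exact heven hv h1
  rw [hS'.ker_inf_eigenspace_eq, hempty] at hxmem
  simpa using hxmem

end IsSerreSystem

end SerreE8

namespace SerreE8

open Module LieAlgebra

variable {h e f : LieAlgebra.e₈ ℂ}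

lemma centralizer_le_iSup (hhe : ⁅h, e⁆ = (2 : ℂ) • e) (hhf : ⁅h, f⁆ = (-2 : ℂ) • f)
    (hef : ⁅e, f⁆ = h) [FiniteDimensional ℂ (LieAlgebra.e₈ ℂ)] :
    centralizer e ≤ ⨆ n : ℕ, centralizer e ⊓ (ad ℂ _ h).eigenspace (n : ℂ) := by
  have S := sl2Ops_ad hhe hhf hef
  have htop : ⨆ μ, (ad ℂ _ h).eigenspace μ = ⊤ := by
    rw [eq_top_iff, ← S.iSup_eigenspace_h]
    exact iSup_le fun n => le_iSup _ (n : ℂ)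
  have hst : ∀ x ∈ centralizer e, ad ℂ _ h x ∈ centralizer e := by
    intro x hx
    rw [centralizer, LinearMap.mem_ker, ad_apply] at hx ⊢
    rw [ad_apply, leibniz_lie, hx, ← lie_skew e h, hhe]
    simp [hx]
  conv_lhs => rw [Submodule.eq_iSup_inf_genEigenspace 1 hst htop]
  refine iSup_le fun μ x ⟨hx, hxμ⟩ => ?_
  by_cases hx0 : x = 0
  · rw [hx0]; exact zero_mem _
  obtain ⟨h1, i, rfl⟩ := S.apply_eq_smul_of_e_eq_zero
    (((ad ℂ _ h).genEigenspace μ).monotone le_top hxμ) hx0 hx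
  exact Submodule.mem_iSup_of_mem i ⟨hx, Module.End.mem_eigenspace_iff.2 h1⟩

lemma mem_derived_of_odd [FiniteDimensional ℂ (LieAlgebra.e₈ ℂ)] {t₀ : LieAlgebra.e₈ ℂ}
    (het₀ : ⁅e, t₀⁆ = 0) (hht₀ : ⁅h, t₀⁆ = 0) {n : ℂ}
    (hinj : ∀ x : LieAlgebra.e₈ ℂ, ⁅h, x⁆ = n • x → ⁅t₀, x⁆ = 0 → x = 0) :
    centralizer e ⊓ (ad ℂ _ h).eigenspace n ≤ derived e := by
  have hst : ∀ x ∈ centralizer e ⊓ (ad ℂ _ h).eigenspace n,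
      ad ℂ _ t₀ x ∈ centralizer e ⊓ (ad ℂ _ h).eigenspace n := by
    rintro x ⟨hx, hx'⟩
    rw [SetLike.mem_coe, Module.End.mem_eigenspace_iff, ad_apply] at hx'
    rw [SetLike.mem_coe, centralizer, LinearMap.mem_ker, ad_apply] at hx
    constructor
    · rw [SetLike.mem_coe, centralizer, LinearMap.mem_ker, ad_apply, ad_apply, leibniz_lie, hx,
        het₀]
      simp
    · rw [SetLike.mem_coe, Module.End.mem_eigenspace_iff, ad_apply, ad_apply, leibniz_lie, hx',
        hht₀]
      simp
  have hinj' : Function.Injective ((ad ℂ _ t₀).restrict hst) := by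
    rw [← LinearMap.ker_eq_bot, LinearMap.ker_eq_bot']
    rintro ⟨x, hx⟩ h0
    exact Subtype.ext (hinj x (Module.End.mem_eigenspace_iff.1 hx.2) (congrArg Subtype.val h0))
  intro x hx
  obtain ⟨⟨y, hy⟩, hyx⟩ := LinearMap.injective_iff_surjective.1 hinj' ⟨x, hx⟩
  exact Submodule.subset_span ⟨t₀, het₀, y, hy.1, congrArg Subtype.val hyx⟩

end SerreE8

/-- In type E₈, every eigenvalue of the endomorphism of `g_e/[g_e,g_e]` induced by `ad h`
is a non-negative even integer. -/
theorem eigenvalues_even_E8 (h e f : LieAlgebra.e₈ ℂ)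
    (hhe : ⁅h, e⁆ = (2 : ℂ) • e) (hhf : ⁅h, f⁆ = (-2 : ℂ) • f) (hef : ⁅e, f⁆ = h)
    (φ : Module.End ℂ
      (↥(centralizer e) ⧸ (derived e).comap (centralizer e).subtype))
    (hφ : ∀ x y : ↥(centralizer e), (y : LieAlgebra.e₈ ℂ) = ⁅h, (x : LieAlgebra.e₈ ℂ)⁆ →
      φ (Submodule.Quotient.mk x) = Submodule.Quotient.mk y)
    (μ : ℂ) (hμ : φ.HasEigenvalue μ) :
    ∃ n : ℕ, Even n ∧ μ = (n : ℂ) := by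
  obtain ⟨H, E, F, hS⟩ := SerreE8.exists_isSerreSystem
  have := hS.finiteDimensional
  obtain ⟨q, hq⟩ := hμ.exists_hasEigenvector
  have hnt : Nontrivial (LieAlgebra.e₈ ℂ) := by
    by_contra hsub
    rw [not_nontrivial_iff_subsingleton] at hsub
    exact hq.2 (Subsingleton.elim _ _)
  obtain ⟨t₀, het₀, hht₀, hodd⟩ := hS.exists_forall_odd_eq_zero hhe hhf hef
  by_contra hcon
  have htop : ⨆ n : {n : ℕ // Even n}, φ.eigenspace ((n : ℕ) : ℂ) = ⊤ := by
    set W := ⨆ n : {n : ℕ // Even n}, φ.eigenspace ((n : ℕ) : ℂ)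
    have hle : centralizer e ≤
        (W.comap ((derived e).comap (centralizer e).subtype).mkQ).map (centralizer e).subtype := by
      refine (SerreE8.centralizer_le_iSup hhe hhf hef).trans (iSup_le fun n x hx => ?_)
      refine ⟨⟨x, hx.1⟩, ?_, rfl⟩
      rw [SetLike.mem_coe, Submodule.mem_comap, Submodule.mkQ_apply]
      by_cases hn : Even n
      · refine Submodule.mem_iSup_of_mem ⟨n, hn⟩ (Module.End.mem_eigenspace_iff.2 ?_)
        rw [hφ ⟨x, hx.1⟩ ((n : ℂ) • ⟨x, hx.1⟩) (Module.End.mem_eigenspace_iff.1 hx.2).symm,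
          Submodule.Quotient.mk_smul]
      · have h1 : x ∈ derived e := SerreE8.mem_derived_of_odd het₀ hht₀ (fun y hy => hodd n y
          (by simpa using hn) (by rw [hy, Int.cast_natCast])) hx
        rw [(Submodule.Quotient.mk_eq_zero _).2 (show (⟨x, hx.1⟩ : centralizer e) ∈
          (derived e).comap (centralizer e).subtype from h1)]
        exact zero_mem _
    rw [eq_top_iff]
    intro q _
    obtain ⟨x, rfl⟩ := Submodule.mkQ_surjective _ q
    obtain ⟨y, hy, hyx⟩ := hle x.2
    rw [← Subtype.ext hyx]
    exact hy
  have hbot : φ.eigenspace μ = ⊥ := by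
    refine disjoint_self.1 ((Module.End.eigenspaces_iSupIndep φ μ).mono_right
      (le_top.trans (htop ▸ iSup_le fun n => ?_)))
    exact le_iSup₂_of_le (n : ℂ) (fun h => hcon ⟨n, n.2, h.symm⟩) le_rfl
  exact hμ hbot
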